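/- arXiv:1101.1246 — 13 statements merged into one kernel-verified Lean document; each statement's English description precedes it below -/
import Mathlib

section
/- Let S and T be zero-diagonal symmetric matrices over GF(2) indexed by the same finite set. Then S ∼_lc T if and only if S ∼_mi T. -/
open Matrix

/-- The simple local complement of `S` at `i`: toggle `S j k` whenever
`j ≠ k`, `i ∉ {j, k}`, and `S i j ≠ 0 ≠ S i k`. -/
def slc {n : Type*} [DecidableEq n] (S : Matrix n n (ZMod 2)) (i : n) :
    Matrix n n (ZMod 2) :=
  fun j k => if j ≠ k ∧ i ≠ j ∧ i ≠ k then S j k + S i j * S i k else S j k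

/-- `S ∼_lc T` : `T` is obtained from `S` by a finite sequence of simple
local complementations. -/
def LCRel {n : Type*} [DecidableEq n] (S T : Matrix n n (ZMod 2)) : Prop :=
  Relation.ReflTransGen (fun A B : Matrix n n (ZMod 2) => ∃ i, B = slc A i) S T

/-- `T` is a modified inverse of `S`: toggle some diagonal entries of `S` to
obtain an invertible symmetric matrix `S'`, then set every diagonal entry
of `S'⁻¹` to `0`. -/
def IsModifiedInverse {n : Type*} [Fintype n] [DecidableEq n]
    (S T : Matrix n n (ZMod 2)) : Prop :=
  ∃ S' : Matrix n n (ZMod 2), S'.IsSymm ∧ IsUnit S' ∧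
    (∀ j k, j ≠ k → S' j k = S j k) ∧
    ∀ j k, T j k = if j = k then 0 else S'⁻¹ j k

/-- `S ∼_mi T` : `T` is obtained from `S` by a finite sequence of modified
inversions. -/
def MIRel {n : Type*} [Fintype n] [DecidableEq n] (S T : Matrix n n (ZMod 2)) : Prop :=
  Relation.ReflTransGen (fun A B : Matrix n n (ZMod 2) => IsModifiedInverse A B) S T

namespace LocalComplement

variable {n : Type*} [DecidableEq n]

lemma zmod_two_mul_self (a : ZMod 2) : a * a = a := by
  revert a; decide

lemma zmod_two_eq_one_of_ne_zero {a : ZMod 2} (h : a ≠ 0) : a = 1 := by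
  revert a; decide

lemma slc_isSymm {A : Matrix n n (ZMod 2)} (hA : A.IsSymm) (i : n) : (slc A i).IsSymm := by
  ext j k
  have h := hA.apply j k
  simp only [transpose_apply, slc]
  grind

lemma slc_diag {A : Matrix n n (ZMod 2)} (hA : ∀ j, A j j = 0) (i j : n) : slc A i j j = 0 := by
  simp [slc, hA]

/-- Simple local complementation as a rank-one update with its diagonal removed. -/
lemma slc_eq_add {A : Matrix n n (ZMod 2)} (hA0 : ∀ j, A j j = 0) (i : n) :
    slc A i = A + vecMulVec (A i) (A i) + diagonal (A i) := by
  ext j k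
  have h2 := zmod_two_mul_self (A i j)
  have h3 := CharTwo.add_self_eq_zero (A i j)
  have h0 := hA0 i
  simp only [slc, Matrix.add_apply, vecMulVec_apply, diagonal_apply]
  by_cases hjk : j = k
  · subst hjk; simp [h2, add_assoc, h3]
  · by_cases hj : i = j
    · subst hj; simp [hjk, h0]
    · by_cases hk : i = k
      · subst hk; simp [hjk, h0]
      · simp [hjk, hj, hk]

lemma lcRel_slc (A : Matrix n n (ZMod 2)) (i : n) : LCRel A (slc A i) :=
  Relation.ReflTransGen.single ⟨i, rfl⟩

/-- A matrix agreeing off the diagonal with a zero-diagonal matrix differs from it by its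
diagonal. -/
lemma eq_add_diagonal {M A : Matrix n n (ZMod 2)} (hA0 : ∀ j, A j j = 0)
    (h : ∀ j k, j ≠ k → M j k = A j k) : M = A + diagonal (fun j => M j j) := by
  ext j k
  by_cases hjk : j = k
  · subst hjk; simp [hA0]
  · simp [hjk, h j k hjk]

variable [Fintype n]

lemma slc_mulVec {A : Matrix n n (ZMod 2)} (hA0 : ∀ j, A j j = 0)
    (i : n) (u : n → ZMod 2) (j : n) :
    (slc A i *ᵥ u) j = (A *ᵥ u) j + A i j * (A *ᵥ u) i + A i j * u j := by
  rw [slc_eq_add hA0]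
  simp only [add_mulVec, Pi.add_apply, mulVec_diagonal, vecMulVec_mulVec]
  simp [mulVec]

/-- `B` is obtained from `A` by applying at each index `j` the invertible matrix
`!![a j, b j; c j, d j]` to the pair `(x j, (A *ᵥ x) j)`. -/
structure LocallyEquiv (A B : Matrix n n (ZMod 2)) (a b c d : n → ZMod 2) : Prop where
  det_eq_one : ∀ j, a j * d j + b j * c j = 1
  map_graph : ∀ x j, c j * x j + d j * (A *ᵥ x) j =
    (B *ᵥ (fun k => a k * x k + b k * (A *ᵥ x) k)) j

lemma LocallyEquiv.slc_left {A B : Matrix n n (ZMod 2)} {a b c d : n → ZMod 2}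
    (hA : A.IsSymm) (hA0 : ∀ j, A j j = 0) (h : LocallyEquiv A B a b c d) (i : n) :
    LocallyEquiv (slc A i) B
      (fun j => a j + b j * A i j) (fun j => b j + a j * (Pi.single i 1 : n → ZMod 2) j)
      (fun j => c j + d j * A i j) (fun j => d j + c j * (Pi.single i 1 : n → ZMod 2) j) := by
  have hNe (j : n) : A i j * (Pi.single i 1 : n → ZMod 2) j = 0 := by
    by_cases hj : j = i
    · subst hj; simp [hA0]
    · simp [hj]
  constructor
  · intro j
    have h1 := h.det_eq_one j
    have h2 := hNe j
    have h3 := CharTwo.add_self_eq_zero (a j * c j * (Pi.single i 1 : n → ZMod 2) j)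
    have h4 := CharTwo.add_self_eq_zero (b j * d j * A i j)
    linear_combination h1 + h3 + h4 + (b j * c j + a j * d j) * h2
  · intro u
    set v := slc A i *ᵥ u with hv
    have hvi : v i = (A *ᵥ u) i := by simp [hv, slc_mulVec hA0, hA0]
    set x : n → ZMod 2 := u + v i • Pi.single i 1 with hx
    have hAx (j : n) : (A *ᵥ x) j = v j + A i j * u j := by
      rw [hx, mulVec_add, mulVec_smul, hv, slc_mulVec hA0 i u j, ← hv, hvi]
      have h3 := CharTwo.add_self_eq_zero (A i j * u j)
      have h4 := hA.apply i j
      simp only [Pi.add_apply, Pi.smul_apply, mulVec_single_one, col_apply, smul_eq_mul, h4]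
      linear_combination -h3
    have hxj (j : n) : x j = u j + (Pi.single i 1 : n → ZMod 2) j * v j := by
      by_cases hj : j = i
      · subst hj; simp [hx]
      · simp [hx, hj]
    intro j
    have key := h.map_graph x j
    have harg : (fun k => a k * x k + b k * (A *ᵥ x) k) =
        fun k => (a k + b k * A i k) * u k +
          (b k + a k * (Pi.single i 1 : n → ZMod 2) k) * v k := by
      funext k
      rw [hAx, hxj]; ring
    rw [harg, hAx, hxj] at key
    rw [← key]; ring

lemma LocallyEquiv.eq_of_forall_eq_zero {A B : Matrix n n (ZMod 2)} {a b c d : n → ZMod 2}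
    (hA0 : ∀ j, A j j = 0) (hB0 : ∀ j, B j j = 0) (h : LocallyEquiv A B a b c d)
    (hb : ∀ j, b j = 0) : A = B := by
  have had (j : n) : a j = 1 ∧ d j = 1 := by
    have h1 := h.det_eq_one j
    rw [hb] at h1
    revert h1
    generalize a j = p, d j = q, c j = r
    revert p q r; decide
  ext j k
  have key := h.map_graph (Pi.single k 1) j
  simp only [hb, (had _).1, (had _).2, one_mul, zero_mul, add_zero] at key
  by_cases hjk : j = k
  · subst hjk; rw [hA0, hB0]
  · simpa [hjk] using key

/-- Every index where `a` vanishes has a neighbour in the support of `b`. -/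
lemma LocallyEquiv.exists_neighbor {A B : Matrix n n (ZMod 2)} {a b c d : n → ZMod 2}
    (hA0 : ∀ j, A j j = 0) (h : LocallyEquiv A B a b c d) {i : n} (ha : a i = 0) :
    ∃ j, b j ≠ 0 ∧ A j i ≠ 0 := by
  by_contra! hcon
  have hzero : (fun k => a k * (Pi.single i 1 : n → ZMod 2) k +
      b k * (A *ᵥ Pi.single i 1) k) = 0 := by
    funext k
    have h1 : b k * A k i = 0 := by
      by_cases hb : b k = 0
      · simp [hb]
      · simp [hcon k hb]
    by_cases hk : k = i
    · subst hk; simp [ha, h1]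
    · simp [hk, h1]
  have key := h.map_graph (Pi.single i 1) i
  rw [hzero] at key
  have h1 := h.det_eq_one i
  simp only [Pi.single_eq_same, mulVec_single_one, col_apply, hA0, mulVec_zero, Pi.zero_apply,
    mul_one, mul_zero, add_zero] at key
  simp [ha, key] at h1

theorem LocallyEquiv.lcRel {A B : Matrix n n (ZMod 2)} {a b c d : n → ZMod 2}
    (hA : A.IsSymm) (hA0 : ∀ j, A j j = 0) (hB0 : ∀ j, B j j = 0)
    (h : LocallyEquiv A B a b c d) : LCRel A B := by
  induction hm : (Finset.univ.filter (fun j => b j ≠ 0)).card using Nat.strong_induction_on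
    generalizing A a b c d with
  | _ m ih =>
  subst hm
  -- An index with `a i ≠ 0 ≠ b i` can be removed from the support of `b`.
  have step {A : Matrix n n (ZMod 2)} {a c d : n → ZMod 2} (hA : A.IsSymm)
      (hA0 : ∀ j, A j j = 0) (h : LocallyEquiv A B a b c d) {i : n} (hb : b i ≠ 0)
      (ha : a i ≠ 0) : LCRel A B := by
    refine (lcRel_slc A i).trans
      (ih _ ?_ (slc_isSymm hA i) (slc_diag hA0 i) (h.slc_left hA hA0 i) rfl)
    apply Finset.card_lt_card
    refine Finset.ssubset_iff_of_subset ?_ |>.2 ⟨i, by simpa using hb, ?_⟩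
    · intro j
      by_cases hj : j = i
      · subst hj; simp [hb]
      · simp [hj]
    · simp [zmod_two_eq_one_of_ne_zero hb, zmod_two_eq_one_of_ne_zero ha,
        CharTwo.add_self_eq_zero]
  by_cases hb : ∀ j, b j = 0
  · rw [h.eq_of_forall_eq_zero hA0 hB0 hb]
    exact Relation.ReflTransGen.refl
  push Not at hb
  obtain ⟨i, hi⟩ := hb
  by_cases hai : a i = 0
  · obtain ⟨j, hj, hji⟩ := h.exists_neighbor hA0 hai
    by_cases haj : a j = 0
    · have h' := h.slc_left hA hA0 j
      have hb' : (fun k => b k + a k * (Pi.single j 1 : n → ZMod 2) k) = b := by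
        funext k
        by_cases hk : k = j
        · subst hk; simp [haj]
        · simp [hk]
      rw [hb'] at h'
      exact (lcRel_slc A j).trans
        (step (slc_isSymm hA j) (slc_diag hA0 j) h' hi (by simp [hai, hi, hji]))
    · exact step hA hA0 h hj haj
  · exact step hA hA0 h hi hai

lemma isModifiedInverse_isSymm {A B : Matrix n n (ZMod 2)} (h : IsModifiedInverse A B) :
    B.IsSymm := by
  obtain ⟨S', hS', -, -, hB⟩ := h
  ext j k
  have := hS'.inv.apply j k
  simp only [transpose_apply, hB, this, eq_comm]

lemma isModifiedInverse_diag {A B : Matrix n n (ZMod 2)} (h : IsModifiedInverse A B) (j : n) :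
    B j j = 0 := by
  obtain ⟨S', -, -, -, hB⟩ := h
  simp [hB]

lemma isModifiedInverse_lcRel {A B : Matrix n n (ZMod 2)} (hA : A.IsSymm)
    (hA0 : ∀ j, A j j = 0) (h : IsModifiedInverse A B) : LCRel A B := by
  have hB0 := isModifiedInverse_diag h
  obtain ⟨S', -, hu, hSA, hB⟩ := h
  have hS := eq_add_diagonal hA0 hSA
  have hI := eq_add_diagonal (M := S'⁻¹) hB0 (fun j k hjk => by simp [hB, hjk])
  set e : n → ZMod 2 := fun j => S'⁻¹ j j
  set D : n → ZMod 2 := fun j => S' j j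
  have hinv : S'⁻¹ * S' = 1 := nonsing_inv_mul _ ((isUnit_iff_isUnit_det _).1 hu)
  refine LocallyEquiv.lcRel (a := D) (b := 1) (c := fun j => 1 + e j * D j) (d := e) hA hA0 hB0
    ⟨fun j => ?_, fun x j => ?_⟩
  · have := CharTwo.add_self_eq_zero (e j * D j)
    simp only [Pi.one_apply]
    linear_combination this
  · have hy : (fun k => D k * x k + (1 : n → ZMod 2) k * (A *ᵥ x) k) = S' *ᵥ x := by
      funext k
      conv_rhs => rw [hS]
      simp [add_mulVec, mulVec_diagonal, add_comm]
    have hz : x j = ((B + diagonal e) *ᵥ (S' *ᵥ x)) j := by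
      rw [← hI, mulVec_mulVec, hinv, one_mulVec]
    have hyj := congrFun hy j
    simp only [Pi.one_apply, one_mul] at hyj
    rw [hy]
    rw [add_mulVec, Pi.add_apply, mulVec_diagonal, ← hyj] at hz
    have := CharTwo.add_self_eq_zero (e j * (D j * x j + (A *ᵥ x) j))
    linear_combination hz + this

/-- Diagonal entries outside of `X` can be chosen so as to make a matrix invertible, provided the
rows in `X` together with the unit rows outside of `X` form an invertible matrix. -/
lemma exists_diagonal_det_eq_one (A : Matrix n n (ZMod 2)) (X : Finset n)
    (hX : (of fun j => if j ∈ X then A j else Pi.single j 1).det = 1) :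
    ∃ D : n → ZMod 2, (∀ j ∈ X, D j = 0) ∧ (A + diagonal D).det = 1 := by
  induction hm : Xᶜ.card generalizing A X with
  | zero =>
    have : X = Finset.univ := by simpa using hm
    subst this
    exact ⟨0, by simp, by simpa using! hX⟩
  | succ m ih =>
    obtain ⟨k, hk⟩ : Xᶜ.Nonempty := Finset.card_pos.1 (by omega)
    have hkX : k ∉ X := by simpa using hk
    set M : Matrix n n (ZMod 2) := of fun j => if j ∈ X then A j else Pi.single j 1 with hM
    have hMk : M.updateRow k (Pi.single k 1) = M := by
      conv_rhs => rw [← updateRow_eq_self M k]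
      congr 1
      funext l
      simp [hM, hkX]
    obtain ⟨t, ht⟩ : ∃ t : ZMod 2, (M.updateRow k (A k)).det + t * M.det = 1 :=
      ⟨1 - (M.updateRow k (A k)).det, by rw [hX]; ring⟩
    have hdet : (of fun j => if j ∈ insert k X then (A + diagonal (Pi.single k t)) j
        else Pi.single j 1).det = 1 := by
      rw [← hMk, updateRow_idem, ← det_updateRow_smul, ← det_updateRow_add] at ht
      refine (congrArg det ?_).trans ht
      ext j l
      by_cases hj : j = k
      · subst hj
        by_cases hl : l = j
        · subst hl; simp
        · simp [hl, Ne.symm hl]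
      · by_cases hjX : j ∈ X <;> simp [hj, hjX, hM, diagonal_apply]
    obtain ⟨D, hD, hDdet⟩ := ih (A + diagonal (Pi.single k t)) (insert k X) hdet (by
      rw [Finset.compl_insert, Finset.card_erase_of_mem hk, hm]; rfl)
    refine ⟨Pi.single k t + D, fun j hj => ?_, ?_⟩
    · have hjk : j ≠ k := fun h => hkX (h ▸ hj)
      simp [hjk, hD j (Finset.mem_insert_of_mem hj)]
    · rw [← hDdet, add_assoc, diagonal_add]
      rfl

lemma exists_diagonal_det_eq_one_of_ne_zero {A : Matrix n n (ZMod 2)} (hA : A.IsSymm)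
    (hA0 : ∀ j, A j j = 0)
    {i j : n} (hij : A i j ≠ 0) :
    ∃ D : n → ZMod 2, D i = 0 ∧ (A + diagonal D).det = 1 := by
  suffices hX : (of fun k => if k ∈ ({i, j} : Finset n) then A k else Pi.single k 1).det ≠ 0 by
    obtain ⟨D, hD, hdet⟩ :=
      exists_diagonal_det_eq_one A {i, j} (zmod_two_eq_one_of_ne_zero hX)
    exact ⟨D, hD i (by simp), hdet⟩
  rw [Ne, ← exists_mulVec_eq_zero_iff]
  rintro ⟨v, hv, hMv⟩
  have hout (k : n) (hk : k ∉ ({i, j} : Finset n)) : v k = 0 := by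
    have := congrFun hMv k
    simpa only [mulVec, of_apply, if_neg hk, single_one_dotProduct, Pi.zero_apply] using! this
  have hrow (p q : n) (hpq : ({p, q} : Finset n) = {i, j}) (hA' : A p q ≠ 0) : v q = 0 := by
    have h1 := congrFun hMv p
    have hp : p ∈ ({i, j} : Finset n) := by simp [← hpq]
    have h2 : A p ⬝ᵥ v = A p q * v q := by
      refine Finset.sum_eq_single q (fun l _ hl => ?_) (by simp)
      by_cases hlp : l = p
      · rw [hlp, hA0, zero_mul]
      · rw [hout l (by simp [← hpq, hl, hlp]), mul_zero]
    have h3 : A p ⬝ᵥ v = 0 := by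
      simpa only [mulVec, of_apply, if_pos hp, Pi.zero_apply] using! h1
    exact (mul_eq_zero.1 (h2.symm.trans h3)).resolve_left hA'
  refine hv (funext fun k => ?_)
  by_cases hk : k ∈ ({i, j} : Finset n)
  · rcases Finset.mem_insert.1 hk with rfl | hk
    · exact hrow j k (Finset.pair_comm _ _) (by rwa [hA.apply])
    · rw [Finset.mem_singleton.1 hk]
      exact hrow i j rfl hij
  · exact hout k hk

lemma miRel_slc {A : Matrix n n (ZMod 2)} (hA : A.IsSymm) (hA0 : ∀ j, A j j = 0) (i : n) :
    MIRel A (slc A i) := by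
  by_cases hi : ∀ j, A i j = 0
  · have : slc A i = A := by
      ext j k
      simp [slc, hi]
    rw [this]
    exact Relation.ReflTransGen.refl
  push Not at hi
  obtain ⟨j, hij⟩ := hi
  obtain ⟨D, hDi, hdet⟩ := exists_diagonal_det_eq_one_of_ne_zero hA hA0 hij
  set P : Matrix n n (ZMod 2) := A + diagonal D with hP
  have hPunit : IsUnit P.det := by simp [hdet]
  have hPsymm : P.IsSymm := hA.add (isSymm_diagonal D)
  have hPi : P i = A i := by
    funext k
    by_cases hk : i = k
    · subst hk; simp [hP, hDi]
    · simp [hP, hk]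
  set e : n → ZMod 2 := Pi.single i 1 with he
  set Q : Matrix n n (ZMod 2) := P⁻¹ + vecMulVec e e with hQ
  set R : Matrix n n (ZMod 2) := P + vecMulVec (A i) (A i) with hR
  have hPe : P *ᵥ e = A i := by
    funext k
    rw [he, mulVec_single_one, col_apply, hPsymm.apply, hPi]
  have heP : e ᵥ* P = A i := by
    rw [he, single_one_vecMul, ← hPi]
    rfl
  have hPinv : P⁻¹ *ᵥ A i = e := by
    rw [← hPe, mulVec_mulVec, nonsing_inv_mul _ hPunit, one_mulVec]
  have hQR : Q * R = 1 := by
    have heA : e ⬝ᵥ A i = 0 := by rw [he, single_one_dotProduct, hA0]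
    have htwo : vecMulVec e (A i) + vecMulVec e (A i) = 0 :=
      ext fun _ _ => CharTwo.add_self_eq_zero _
    clear_value P
    rw [hQ, hR, add_mul, mul_add, mul_add, nonsing_inv_mul _ hPunit, mul_vecMulVec, hPinv,
      vecMulVec_mul, heP, vecMulVec_mul_vecMulVec, heA, zero_smul, vecMulVec_zero, add_zero,
      add_assoc, htwo, add_zero]
  have hQunit : IsUnit Q := IsUnit.of_mul_eq_one _ hQR
  have hQinv : Q⁻¹ = R := inv_eq_right_inv hQR
  refine (Relation.ReflTransGen.single
    (b := of fun j k => if j = k then 0 else P⁻¹ j k) ?_).tail ?_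
  · exact ⟨P, hPsymm, (isUnit_iff_isUnit_det _).2 hPunit,
      fun j k hjk => by simp [hP, hjk], fun j k => rfl⟩
  · refine ⟨Q, hPsymm.inv.add ?_, hQunit, fun j k hjk => ?_, fun j k => ?_⟩
    · exact transpose_vecMulVec e e
    · have : e j * e k = 0 := by
        by_cases hj : j = i
        · simp [he, show k ≠ i from fun h => hjk (hj.trans h.symm)]
        · simp [he, hj]
      simp [hQ, hjk, vecMulVec_apply, this]
    · by_cases hjk : j = k
      · subst hjk; simp [slc_diag hA0]
      · rw [hQinv, slc_eq_add hA0]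
        simp [hjk, hR, hP]

end LocalComplement

open LocalComplement

/-- **Theorem (Statement 0).** For zero-diagonal symmetric matrices over `GF(2)`,
`S ∼_lc T` if and only if `S ∼_mi T`. -/
theorem lc_iff_mi {n : Type*} [Fintype n] [DecidableEq n]
    (S T : Matrix n n (ZMod 2))
    (hS : S.IsSymm) (hS0 : ∀ i, S i i = 0)
    (hT : T.IsSymm) (hT0 : ∀ i, T i i = 0) :
    LCRel S T ↔ MIRel S T := by
  constructor
  · intro h
    suffices T.IsSymm ∧ (∀ i, T i i = 0) ∧ MIRel S T from this.2.2
    clear hT hT0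
    induction h with
    | refl => exact ⟨hS, hS0, Relation.ReflTransGen.refl⟩
    | tail _ hstep ih =>
      obtain ⟨i, rfl⟩ := hstep
      exact ⟨slc_isSymm ih.1 i, slc_diag ih.2.1 i, ih.2.2.trans (miRel_slc ih.1 ih.2.1 i)⟩
  · intro h
    suffices T.IsSymm ∧ (∀ i, T i i = 0) ∧ LCRel S T from this.2.2
    clear hT hT0
    induction h with
    | refl => exact ⟨hS, hS0, Relation.ReflTransGen.refl⟩
    | tail _ hstep ih =>
      exact ⟨isModifiedInverse_isSymm hstep, isModifiedInverse_diag hstep,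
        ih.2.2.trans (isModifiedInverse_lcRel ih.1 ih.2.1 hstep)⟩
end

section
/- Let S and T be zero-diagonal symmetric matrices over GF(2) indexed by the same finite set. If S ∼_mi T, then S ∼_lc T. -/
open Matrix

/-- The map `(x, y) ↦ (a * x + b * y, c * x + d * y)`, invertible at every coordinate, carries
the graph of `S` into the graph of `T`. -/
def GraphTransform {n : Type*} [Fintype n] (S T : Matrix n n (ZMod 2))
    (a b c d : n → ZMod 2) : Prop :=
  (∀ v, a v * d v + b v * c v = 1) ∧
    ∀ x, c * x + d * (S *ᵥ x) = T *ᵥ (a * x + b * (S *ᵥ x))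

lemma zmod_two_eq_one {a : ZMod 2} (h : a ≠ 0) : a = 1 := by
  revert a; decide

section

variable {n : Type*} [DecidableEq n] {S T : Matrix n n (ZMod 2)}

lemma slc_isSymm (hS : S.IsSymm) (i : n) : (slc S i).IsSymm := by
  ext j k
  simp only [Matrix.transpose_apply, slc, hS.apply k j, mul_comm (S i k)]
  congr 1
  simp only [eq_iff_iff]
  tauto

lemma slc_apply_self (i j : n) : slc S i j j = S j j := by
  simp [slc]

lemma slc_eq_add (hS0 : ∀ i, S i i = 0) (i : n) :
    slc S i = S + vecMulVec (S i) (S i) + diagonal (S i) := by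
  ext j k
  have hsq : ∀ a : ZMod 2, a * a + a = 0 := by decide
  simp only [slc, Matrix.add_apply, vecMulVec_apply]
  by_cases hjk : j = k
  · subst hjk
    simp [add_assoc, hsq]
  · rw [diagonal_apply_ne _ hjk]
    by_cases hj : i = j
    · subst hj; simp [hS0]
    · by_cases hk : i = k
      · subst hk; simp [hS0]
      · simp [hjk, hj, hk]

variable [Fintype n]

/-- Composing with the inverse of the coordinatewise map induced by a local complementation. -/
lemma GraphTransform.slc {a b c d : n → ZMod 2} (h : GraphTransform S T a b c d)
    (hS : S.IsSymm) (hS0 : ∀ i, S i i = 0) (i : n) :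
    GraphTransform (slc S i) T (a + b * S i) (b + Pi.single i 1 * a)
      (c + d * S i) (d + Pi.single i 1 * c) := by
  have two : (2 : ZMod 2) = 0 := rfl
  refine ⟨fun v => ?_, fun x => ?_⟩
  · have hv := h.1 v
    by_cases hvi : v = i
    · subst hvi
      simp only [Pi.add_apply, Pi.mul_apply, Pi.single_eq_same, hS0]
      linear_combination hv + a v * c v * two
    · simp only [Pi.add_apply, Pi.mul_apply, Pi.single_eq_of_ne hvi]
      linear_combination hv + b v * d v * S i v * two
  · set s := S i with hs
    set z : n → ZMod 2 := _root_.slc S i *ᵥ x with hz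
    have hz' : z = S *ᵥ x + (s ⬝ᵥ x) • s + s * x := by
      rw [hz, slc_eq_add hS0]
      ext v
      simp [Matrix.add_mulVec, vecMulVec_mulVec, mulVec_diagonal, hs, mul_comm]
    have hzi : z i = s ⬝ᵥ x := by
      rw [hz']
      simp [hs, hS0, Matrix.mulVec]
    have hcol : S *ᵥ Pi.single i (1 : ZMod 2) = s := by
      ext v
      simp [hs, hS.apply]
    have hsingle : Pi.single i 1 * z = (s ⬝ᵥ x) • (Pi.single i 1 : n → ZMod 2) := by
      ext v
      by_cases hvi : v = i
      · subst hvi; simp [hzi]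
      · simp [hvi]
    have hy : S *ᵥ (x + Pi.single i 1 * z) = z + s * x := by
      rw [hsingle, Matrix.mulVec_add, Matrix.mulVec_smul, hcol, hz']
      ext v
      simp only [Pi.add_apply, Pi.mul_apply]
      linear_combination (- (s v * x v)) * two
    have key := h.2 (x + Pi.single i 1 * z)
    rw [hy] at key
    convert key using 1
    · ring
    · congr 1; ring

lemma GraphTransform.eq_of_forall_eq_zero {a b c d : n → ZMod 2}
    (h : GraphTransform S T a b c d) (hb : ∀ v, b v = 0)
    (hS0 : ∀ i, S i i = 0) (hT0 : ∀ i, T i i = 0) : S = T := by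
  have had : ∀ p q r : ZMod 2, p * q + 0 * r = 1 → p = 1 ∧ q = 1 := by decide
  have had' := fun v => had (a v) (d v) (c v) (by simpa [hb] using h.1 v)
  have ha : a = 1 := funext fun v => (had' v).1
  have hd : d = 1 := funext fun v => (had' v).2
  have hb' : b = 0 := funext hb
  ext j k
  by_cases hjk : j = k
  · subst hjk; rw [hS0, hT0]
  · have := congrFun (h.2 (Pi.single k 1)) j
    simpa [ha, hd, hb', hjk] using this

/-- A coordinate with `a i = 0` is adjacent to a coordinate with `b j ≠ 0`. -/
lemma GraphTransform.exists_adj {a b c d : n → ZMod 2}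
    (h : GraphTransform S T a b c d) (hS0 : ∀ i, S i i = 0)
    {i : n} (ha : a i = 0) : ∃ j, b j ≠ 0 ∧ S j i ≠ 0 := by
  by_contra! hno
  have hx : a * Pi.single i 1 + b * (S *ᵥ Pi.single i 1) = 0 := by
    ext v
    by_cases hv : v = i
    · subst hv; simp [ha, hS0]
    · by_cases hb : b v = 0
      · simp [hv, hb]
      · simp [hv, hno v hb]
  have hi := congrFun (h.2 (Pi.single i 1)) i
  rw [hx] at hi
  have hc : c i = 0 := by simpa [hS0] using hi
  simpa [ha, hc] using h.1 i

lemma GraphTransform.lcRel (hT0 : ∀ i, T i i = 0) (N : ℕ) :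
    ∀ (S : Matrix n n (ZMod 2)) (a b c d : n → ZMod 2), S.IsSymm → (∀ i, S i i = 0) →
      GraphTransform S T a b c d → (Finset.univ.filter fun v => b v ≠ 0).card = N →
      LCRel S T := by
  induction N using Nat.strong_induction_on with
  | _ N ih =>
    have reduce : ∀ (S : Matrix n n (ZMod 2)) (a b c d : n → ZMod 2), S.IsSymm →
        (∀ i, S i i = 0) → GraphTransform S T a b c d →
        (Finset.univ.filter fun v => b v ≠ 0).card = N →
        (∃ i, a i ≠ 0 ∧ b i ≠ 0) → LCRel S T := by
      rintro S a b c d hS hS0 h hN ⟨i, hai, hbi⟩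
      refine Relation.ReflTransGen.head ⟨i, rfl⟩ (ih _ ?_ _ _ _ _ _ (slc_isSymm hS i)
        (fun j => (slc_apply_self i j).trans (hS0 j)) (h.slc hS hS0 i) rfl)
      rw [← hN]
      refine Finset.card_lt_card (Finset.ssubset_iff_of_subset ?_ |>.2 ⟨i, by simpa using hbi, ?_⟩)
      · intro v
        by_cases hv : v = i
        · subst hv; simp [hbi]
        · simp [hv]
      · simp [zmod_two_eq_one hai, zmod_two_eq_one hbi, show (1 + 1 : ZMod 2) = 0 from rfl]
    intro S a b c d hS hS0 h hN
    by_cases hab : ∃ i, a i ≠ 0 ∧ b i ≠ 0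
    · exact reduce S a b c d hS hS0 h hN hab
    by_cases hb : ∀ v, b v = 0
    · rw [h.eq_of_forall_eq_zero hb hS0 hT0]
      exact Relation.ReflTransGen.refl
    push Not at hab hb
    obtain ⟨i, hi⟩ := hb
    have ha : ∀ v, b v ≠ 0 → a v = 0 := fun v hv => by_contra fun h' => hv (hab v h')
    obtain ⟨j, hbj, hji⟩ := h.exists_adj hS0 (ha i hi)
    have hb' : b + Pi.single j 1 * a = b := by
      ext v
      by_cases hv : v = j
      · subst hv; simp [ha v hbj]
      · simp [hv]
    refine Relation.ReflTransGen.head ⟨j, rfl⟩ (reduce _ _ _ _ _ (slc_isSymm hS j)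
      (fun k => (slc_apply_self j k).trans (hS0 k)) (h.slc hS hS0 j) ?_ ⟨i, ?_, ?_⟩)
    · rw [hb', hN]
    · simp [ha i hi, hi, hji]
    · rwa [hb']

lemma IsModifiedInverse.isSymm (h : IsModifiedInverse S T) : T.IsSymm := by
  obtain ⟨S', hS', -, -, hT⟩ := h
  have hinv : S'⁻¹.IsSymm := by
    rw [Matrix.IsSymm, Matrix.transpose_nonsing_inv, hS']
  ext j k
  simp only [Matrix.transpose_apply, hT, eq_comm (a := k), hinv.apply]

lemma IsModifiedInverse.apply_self (h : IsModifiedInverse S T) (i : n) : T i i = 0 := by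
  obtain ⟨S', -, -, -, hT⟩ := h
  simp [hT]

lemma IsModifiedInverse.exists_graphTransform (h : IsModifiedInverse S T)
    (hS0 : ∀ i, S i i = 0) : ∃ a b c d, GraphTransform S T a b c d := by
  obtain ⟨S', -, hunit, hoff, hT⟩ := h
  have two : (2 : ZMod 2) = 0 := rfl
  have hdouble : ∀ p : ZMod 2, p + p = 0 := by decide
  set p := S'.diag with hp
  set q := S'⁻¹.diag with hq
  have hSeq : S' = S + diagonal p := by
    ext j k
    by_cases hjk : j = k
    · subst hjk; simp [hp, hS0]
    · simp [hjk, hoff j k hjk]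
  have hTeq : T = S'⁻¹ + diagonal q := by
    ext j k
    by_cases hjk : j = k
    · subst hjk; simp [hq, hT, hdouble]
    · simp [hjk, hT]
  have hinv : S'⁻¹ * S' = 1 := Matrix.nonsing_inv_mul _ ((Matrix.isUnit_iff_isUnit_det _).1 hunit)
  refine ⟨p, 1, 1 + q * p, q, fun v => ?_, fun x => ?_⟩
  · simp only [Pi.add_apply, Pi.mul_apply, Pi.one_apply]
    linear_combination p v * q v * two
  · have hdiag : ∀ r y : n → ZMod 2, diagonal r *ᵥ y = r * y := by
      intro r y
      ext v
      simp [mulVec_diagonal]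
    have hx : p * x + 1 * (S *ᵥ x) = S' *ᵥ x := by
      rw [hSeq, Matrix.add_mulVec, hdiag]
      ring
    rw [hx, hTeq, Matrix.add_mulVec, Matrix.mulVec_mulVec, hinv, Matrix.one_mulVec, hdiag, ← hx]
    ring

lemma IsModifiedInverse.lcRel (h : IsModifiedInverse S T) (hS : S.IsSymm)
    (hS0 : ∀ i, S i i = 0) : LCRel S T := by
  obtain ⟨a, b, c, d, hg⟩ := h.exists_graphTransform hS0
  exact GraphTransform.lcRel h.apply_self _ S a b c d hS hS0 hg rfl

end

/-- **Theorem (Statement 1).** For zero-diagonal symmetric matrices over `GF(2)`,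
if `S ∼_mi T` then `S ∼_lc T`. -/
theorem mi_imp_lc {n : Type*} [Fintype n] [DecidableEq n]
    (S T : Matrix n n (ZMod 2))
    (hS : S.IsSymm) (hS0 : ∀ i, S i i = 0)
    (hT : T.IsSymm) (hT0 : ∀ i, T i i = 0)
    (h : MIRel S T) : LCRel S T := by
  clear hT hT0
  suffices LCRel S T ∧ T.IsSymm ∧ ∀ i, T i i = 0 from this.1
  induction h with
  | refl => exact ⟨Relation.ReflTransGen.refl, hS, hS0⟩
  | tail _ hstep ih =>
    exact ⟨Relation.ReflTransGen.trans ih.1 (hstep.lcRel ih.2.1 ih.2.2), hstep.isSymm,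
      hstep.apply_self⟩
end

section
/- Let S and T be zero-diagonal symmetric matrices over GF(2) indexed by the same finite set. If S ∼_lc T, then S ∼_mi T. -/
open Matrix

/-- If the minor of `M` on the index set `s` is nonzero, then `M` becomes invertible after adding a
suitable diagonal matrix that vanishes on `s`. The minor is written as the determinant of the matrix
whose rows outside `s` are those of the identity. -/
lemma exists_diagonal_det_ne_zero {n K : Type*} [Fintype n] [DecidableEq n] [Field K]
    (M : Matrix n n K) (s : Finset n)
    (hs : (Matrix.of fun k => if k ∈ s then M k else Pi.single k 1).det ≠ 0) :
    ∃ D : n → K, (∀ k ∈ s, D k = 0) ∧ (M + diagonal D).det ≠ 0 := by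
  suffices H : ∀ u : Finset n, ∃ D : n → K, (∀ k ∈ s, D k = 0) ∧
      (Matrix.of fun k => if k ∈ s ∪ u then M k + Pi.single k (D k)
        else Pi.single k 1).det ≠ 0 by
    obtain ⟨D, hD, hdet⟩ := H Finset.univ
    refine ⟨D, hD, ?_⟩
    convert hdet using 2
    ext j k
    simp [diagonal_apply, Pi.single_apply, eq_comm]
  intro u
  induction u using Finset.induction_on with
  | empty =>
    refine ⟨0, fun _ _ => rfl, ?_⟩
    simpa using hs
  | insert a u _ ih =>
    obtain ⟨D, hD, hdet⟩ := ih
    by_cases ha : a ∈ s ∪ u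
    · refine ⟨D, hD, ?_⟩
      rwa [Finset.union_insert, Finset.insert_eq_of_mem ha]
    set B : Matrix n n K := Matrix.of fun k => if k ∈ s ∪ u then M k + Pi.single k (D k)
        else Pi.single k 1 with hB
    have hBa : B.updateRow a (Pi.single a 1) = B := by
      ext j k
      by_cases hj : j = a
      · subst hj
        simp only [updateRow_self, hB, of_apply, if_neg ha]
      · simp [updateRow_ne hj]
    have hrow : ∀ d : K, (Matrix.of fun k => if k ∈ s ∪ insert a u
        then M k + Pi.single k (Function.update D a d k) else Pi.single k 1) =
        B.updateRow a (M a + d • Pi.single a 1) := by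
      intro d
      ext j k
      by_cases hj : j = a
      · subst hj
        simp [Pi.single_apply]
      · simp [hB, hj]
    have hval : ∀ d : K, (B.updateRow a (M a + d • Pi.single a 1)).det =
        (B.updateRow a (M a)).det + d * B.det := by
      intro d
      rw [det_updateRow_add, det_updateRow_smul, hBa]
    have hsupp : ∀ d : K, ∀ k ∈ s, Function.update D a d k = 0 := by
      intro d k hk
      have hka : k ≠ a := by
        rintro rfl
        exact ha (Finset.mem_union_left _ hk)
      rw [Function.update_of_ne hka, hD k hk]
    by_cases h0 : (B.updateRow a (M a)).det = 0
    · refine ⟨Function.update D a 1, hsupp 1, ?_⟩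
      rw [hrow, hval, h0]
      simpa using hdet
    · refine ⟨Function.update D a 0, hsupp 0, ?_⟩
      rw [hrow, hval]
      simpa using h0

/-- A symmetric zero-diagonal matrix with a nonzero entry in row `i` becomes invertible after adding
a suitable diagonal matrix that vanishes at `i`. -/
lemma exists_diagonal_det_ne_zero_of_apply_ne_zero {n K : Type*} [Fintype n] [DecidableEq n]
    [Field K] {A : Matrix n n K} (hA : A.IsSymm) (hA0 : ∀ i, A i i = 0) {i j : n}
    (hij : A i j ≠ 0) : ∃ D : n → K, D i = 0 ∧ (A + diagonal D).det ≠ 0 := by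
  obtain ⟨D, hD, hdet⟩ := exists_diagonal_det_ne_zero A {i, j} (by
    intro hdet
    obtain ⟨v, hv, hv0⟩ := exists_mulVec_eq_zero_iff.mpr hdet
    apply hv
    have hout : ∀ k, k ≠ i → k ≠ j → v k = 0 := by
      intro k hki hkj
      simpa [mulVec, hki, hkj] using congrFun hv0 k
    have hi : A i j * v j = 0 := by
      have h := congrFun hv0 i
      simp only [mulVec, dotProduct, of_apply, Finset.mem_insert, true_or, if_true,
        Pi.zero_apply] at h
      rwa [Finset.sum_eq_single j (fun k _ hkj => by
        by_cases hki : k = i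
        · simp [hki, hA0]
        · simp [hout k hki hkj]) (by simp)] at h
    have hj : A j i * v i = 0 := by
      have h := congrFun hv0 j
      simp only [mulVec, dotProduct, of_apply, Finset.mem_insert, Finset.mem_singleton, or_true,
        if_true, Pi.zero_apply] at h
      rwa [Finset.sum_eq_single i (fun k _ hki => by
        by_cases hkj : k = j
        · simp [hkj, hA0]
        · simp [hout k hki hkj]) (by simp)] at h
    rw [hA.apply] at hj
    ext k
    by_cases hki : k = i
    · subst hki
      exact (mul_eq_zero.mp hj).resolve_left hij
    by_cases hkj : k = j
    · subst hkj
      exact (mul_eq_zero.mp hi).resolve_left hij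
    exact hout k hki hkj)
  exact ⟨D, hD i (by simp), hdet⟩

lemma slc_isSymm_s2 {n : Type*} [DecidableEq n] {A : Matrix n n (ZMod 2)} (hA : A.IsSymm) (i : n) :
    (slc A i).IsSymm := by
  ext j k
  have h := hA.apply j k
  simp only [transpose_apply, slc, h, mul_comm (A i k)]
  congr 1
  grind

lemma slc_apply_self_s2 {n : Type*} [DecidableEq n] (A : Matrix n n (ZMod 2)) (i j : n) :
    slc A i j j = A j j := by
  simp [slc]

/-- Adding `1` to the `i`-th diagonal entry of `M⁻¹`, where `M i i = 0`, changes the inverse from `M`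
to `M + M E M` with `E` the matrix unit at `(i, i)`. -/
lemma add_mul_single_mul_mul_inv_add_single {n : Type*} [Fintype n] [DecidableEq n]
    {M : Matrix n n (ZMod 2)}
    (hM : IsUnit M.det) {i : n} (hi : M i i = 0) :
    (M + M * single i i 1 * M) * (M⁻¹ + single i i 1) = 1 := by
  have hE : single i i 1 * M * single i i (1 : ZMod 2) = 0 := by
    rw [single_mul_mul_single, hi]
    simp
  have h2 : M * single i i 1 + M * single i i 1 = 0 := by
    ext j k
    exact CharTwo.add_self_eq_zero _
  calc (M + M * single i i 1 * M) * (M⁻¹ + single i i 1)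
      = M * M⁻¹ + M * single i i 1 + M * single i i 1 * (M * M⁻¹) +
          M * (single i i 1 * M * single i i 1) := by noncomm_ring
    _ = 1 + (M * single i i 1 + M * single i i 1) := by
      rw [hE, mul_nonsing_inv _ hM, mul_one, mul_zero, add_zero, add_assoc]
    _ = 1 := by rw [h2, add_zero]

lemma MIRel_slc {n : Type*} [Fintype n] [DecidableEq n] {A : Matrix n n (ZMod 2)}
    (hA : A.IsSymm) (hA0 : ∀ i, A i i = 0) (i : n) : MIRel A (slc A i) := by
  by_cases hrow : ∀ j, A i j = 0
  · have : slc A i = A := by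
      ext j k
      simp [slc, hrow]
    rw [this]
    exact Relation.ReflTransGen.refl
  push Not at hrow
  obtain ⟨j, hij⟩ := hrow
  obtain ⟨D, hDi, hdet⟩ := exists_diagonal_det_ne_zero_of_apply_ne_zero hA hA0 hij
  set M := A + diagonal D with hM
  have hMsymm : M.IsSymm := hA.add (isSymm_diagonal D)
  have hMi : M i i = 0 := by simp [hM, hA0, hDi]
  have hMoff : ∀ j k, j ≠ k → M j k = A j k := fun j k hjk => by simp [hM, hjk]
  have hunit : IsUnit M.det := hdet.isUnit
  have hinv := add_mul_single_mul_mul_inv_add_single hunit hMi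
  refine (Relation.ReflTransGen.single (b := fun j k => if j = k then 0 else M⁻¹ j k)
    ⟨M, hMsymm, (isUnit_iff_isUnit_det M).mpr hunit, hMoff, fun _ _ => rfl⟩).tail
    ⟨M⁻¹ + single i i 1, ?_, ?_, ?_, ?_⟩
  · refine IsSymm.add ?_ ?_
    · rw [IsSymm, transpose_nonsing_inv, hMsymm.eq]
    · simp [IsSymm]
  · exact IsUnit.of_mul_eq_one _ (mul_eq_one_comm.mp hinv)
  · intro j k hjk
    have : ¬(i = j ∧ i = k) := fun h => hjk (h.1.symm.trans h.2)
    simp [hjk, this]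
  · intro j k
    rw [inv_eq_left_inv hinv]
    split_ifs with hjk
    · rw [hjk, slc_apply_self_s2, hA0]
    have hprod : (M * single i i 1 * M : Matrix n n (ZMod 2)) j k = M j i * M i k := by
      rw [mul_apply, Finset.sum_eq_single i]
      · simp
      · intro l _ hl
        simp [hl]
      · simp
    rw [Matrix.add_apply, hprod, hMoff j k hjk]
    by_cases hji : i = j
    · subst hji
      simp [slc, hMi]
    by_cases hki : i = k
    · subst hki
      simp [slc, hMi]
    rw [hMoff j i (Ne.symm hji), hMoff i k hki, hA.apply i j]
    simp [slc, hjk, hji, hki]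

/-- **Theorem (Statement 2).** For zero-diagonal symmetric matrices over `GF(2)`,
if `S ∼_lc T` then `S ∼_mi T`. -/
theorem lc_imp_mi {n : Type*} [Fintype n] [DecidableEq n]
    (S T : Matrix n n (ZMod 2))
    (hS : S.IsSymm) (hS0 : ∀ i, S i i = 0)
    (hT : T.IsSymm) (hT0 : ∀ i, T i i = 0)
    (h : LCRel S T) : MIRel S T := by
  clear hT hT0
  suffices H : T.IsSymm ∧ (∀ i, T i i = 0) ∧ MIRel S T from H.2.2
  induction h with
  | refl => exact ⟨hS, hS0, Relation.ReflTransGen.refl⟩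
  | tail _ hstep ih =>
    obtain ⟨i, rfl⟩ := hstep
    obtain ⟨hsymm, hzero, hmi⟩ := ih
    exact ⟨slc_isSymm_s2 hsymm i, fun j => by rw [slc_apply_self_s2, hzero],
      Relation.ReflTransGen.trans hmi (MIRel_slc hsymm hzero i)⟩
end

section
/- Let S be a zero-diagonal symmetric matrix over GF(2) and let T be a modified inverse of S. Then S ∼_lc T, i.e., T can be obtained from S by a finite sequence of simple local complementations. -/
open Matrix

section LocalComplementation

variable {n : Type*} [DecidableEq n]

/-- The matrix `M` with its diagonal set to zero. -/
def offDiagPart (M : Matrix n n (ZMod 2)) : Matrix n n (ZMod 2) :=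
  fun j k => if j = k then 0 else M j k

/-- Row `i` of `M` with its entry at `i` set to zero. -/
def neighborVec (M : Matrix n n (ZMod 2)) (i : n) : n → ZMod 2 :=
  fun k => if k = i then 0 else M i k

/-- Local complementation at `i` that also toggles the diagonal entries of the neighbors
of `i`. -/
def fullLC (M : Matrix n n (ZMod 2)) (i : n) : Matrix n n (ZMod 2) :=
  M + vecMulVec (neighborVec M i) (neighborVec M i)

lemma fullLC_isSymm {M : Matrix n n (ZMod 2)} (hM : M.IsSymm) (i : n) :
    (fullLC M i).IsSymm := by
  ext j k
  simp [fullLC, vecMulVec_apply, hM.apply, mul_comm]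

lemma offDiagPart_fullLC (M : Matrix n n (ZMod 2)) (i : n) :
    offDiagPart (fullLC M i) = slc (offDiagPart M) i := by
  ext j k
  simp only [offDiagPart, fullLC, slc, Matrix.add_apply, vecMulVec_apply, neighborVec]
  split_ifs <;> grind

lemma LCRel.of_fullLC {M T : Matrix n n (ZMod 2)} (i : n)
    (h : LCRel (offDiagPart (fullLC M i)) T) : LCRel (offDiagPart M) T :=
  Relation.ReflTransGen.head ⟨i, offDiagPart_fullLC M i⟩ h

variable [Fintype n]

/-- `N` is the principal pivot transform of `M` on `X`: exchanging the coordinates in `X`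
of the input and the output turns the graph of `M` into the graph of `N`. -/
def IsPivot (M N : Matrix n n (ZMod 2)) (X : Finset n) : Prop :=
  ∀ x : n → ZMod 2, N *ᵥ X.piecewise (M *ᵥ x) x = X.piecewise x (M *ᵥ x)

lemma fullLC_mulVec_apply (M : Matrix n n (ZMod 2)) (i : n) (u : n → ZMod 2) (k : n) :
    (fullLC M i *ᵥ u) k = (M *ᵥ u) k + neighborVec M i k * ((M *ᵥ u) i + M i i * u i) := by
  have h : neighborVec M i ⬝ᵥ u = (M *ᵥ u) i + M i i * u i := by
    have hv : neighborVec M i = M i + Pi.single i (M i i) := by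
      ext k
      by_cases hk : k = i
      · subst hk; simp [neighborVec, CharTwo.add_self_eq_zero]
      · simp [neighborVec, hk]
    rw [hv, add_dotProduct, single_dotProduct]
    rfl
  rw [fullLC, add_mulVec, vecMulVec_mulVec, Pi.add_apply, h]
  simp

lemma mulVec_add_single_apply {M : Matrix n n (ZMod 2)} (hM : M.IsSymm) (i : n)
    (u : n → ZMod 2) (c : ZMod 2) (k : n) :
    (M *ᵥ (u + Pi.single i c)) k = (M *ᵥ u) k + M i k * c := by
  rw [mulVec_add, mulVec_single, Pi.add_apply]
  simp [hM.apply]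

/-- Pivoting on a single nonzero diagonal entry is a local complementation. -/
lemma IsPivot.fullLC_erase {M N : Matrix n n (ZMod 2)} {X : Finset n} (hM : M.IsSymm)
    (h : IsPivot M N X) {i : n} (hi : i ∈ X) (hii : M i i = 1) :
    IsPivot (fullLC M i) N (X.erase i) := by
  intro u
  have hx := h (u + Pi.single i ((M *ᵥ u) i + u i))
  have hin : (X.erase i).piecewise (fullLC M i *ᵥ u) u =
      X.piecewise (M *ᵥ (u + Pi.single i ((M *ᵥ u) i + u i)))
        (u + Pi.single i ((M *ᵥ u) i + u i)) := by
    ext k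
    by_cases hk : k = i
    · subst hk
      simp [hi, mulVec_add_single_apply hM, hii]
      grind
    · by_cases hkX : k ∈ X <;>
      simp [hk, hkX, mulVec_add_single_apply hM, fullLC_mulVec_apply, hii, neighborVec]
  rw [hin, hx]
  ext k
  by_cases hk : k = i
  · subst hk
    simp [hi, fullLC_mulVec_apply, neighborVec]
    grind
  · by_cases hkX : k ∈ X <;>
    simp [hk, hkX, mulVec_add_single_apply hM, fullLC_mulVec_apply, hii, neighborVec]

/-- A local complementation at a vertex with zero diagonal entry preserves the pivot relation
up to a diagonal entry. -/
lemma IsPivot.fullLC_add_single {M N : Matrix n n (ZMod 2)} {X : Finset n} (hM : M.IsSymm)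
    (h : IsPivot M N X) {i : n} (hi : i ∈ X) (hii : M i i = 0) :
    IsPivot (fullLC M i) (N + Matrix.single i i 1) X := by
  intro u
  have hx := h (u + Pi.single i ((M *ᵥ u) i))
  have hin : X.piecewise (fullLC M i *ᵥ u) u =
      X.piecewise (M *ᵥ (u + Pi.single i ((M *ᵥ u) i))) (u + Pi.single i ((M *ᵥ u) i)) := by
    ext k
    by_cases hk : k = i
    · subst hk
      simp [hi, mulVec_add_single_apply hM, fullLC_mulVec_apply, hii, neighborVec]
    · by_cases hkX : k ∈ X <;>
      simp [hk, hkX, mulVec_add_single_apply hM, fullLC_mulVec_apply, hii, neighborVec]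
  rw [add_mulVec, hin, hx, single_mulVec]
  ext k
  by_cases hk : k = i
  · subst hk
    simp [hi, mulVec_add_single_apply hM, hii]
    grind
  · by_cases hkX : k ∈ X <;>
    simp [hk, hkX, mulVec_add_single_apply hM, fullLC_mulVec_apply, hii, neighborVec]

lemma IsPivot.exists_apply_ne_zero {M N : Matrix n n (ZMod 2)} {X : Finset n}
    (hM : M.IsSymm) (h : IsPivot M N X) {i : n} (hi : i ∈ X) : ∃ j ∈ X, M i j ≠ 0 := by
  by_contra! hc
  have hx := h (Pi.single i 1)
  have h0 : X.piecewise (M *ᵥ Pi.single i 1) (Pi.single i 1) = 0 := by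
    ext k
    by_cases hk : k ∈ X
    · simp [hk, hM.apply i k, hc]
    · have : k ≠ i := fun e => hk (e ▸ hi)
      simp [hk, this]
  rw [h0, mulVec_zero] at hx
  simpa [hi] using congrFun hx i

/-- Symmetric matrices related by a principal pivot transform are locally equivalent. -/
theorem IsPivot.lcRel {M N : Matrix n n (ZMod 2)} {X : Finset n} (hM : M.IsSymm)
    (h : IsPivot M N X) : LCRel (offDiagPart M) (offDiagPart N) := by
  induction hc : X.card generalizing M N X with
  | zero =>
    obtain rfl := Finset.card_eq_zero.mp hc
    have : N = M := ext_of_mulVec_single fun j => by simpa using h (Pi.single j 1)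
    subst this
    exact Relation.ReflTransGen.refl
  | succ m ih =>
    have loop : ∀ {M N : Matrix n n (ZMod 2)}, M.IsSymm → IsPivot M N X →
        ∀ i ∈ X, M i i = 1 → LCRel (offDiagPart M) (offDiagPart N) :=
      fun hM h i hi hii => .of_fullLC i <| ih (fullLC_isSymm hM i) (h.fullLC_erase hM hi hii)
        (by rw [Finset.card_erase_of_mem hi, hc]; rfl)
    by_cases hl : ∃ i ∈ X, M i i = 1
    · obtain ⟨i, hi, hii⟩ := hl
      exact loop hM h i hi hii
    · have hl0 : ∀ i ∈ X, M i i = 0 := fun i hi => by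
        by_contra h0
        exact hl ⟨i, hi, Fin.eq_one_of_ne_zero _ h0⟩
      obtain ⟨i, hi⟩ : X.Nonempty := Finset.card_pos.mp (by omega)
      obtain ⟨j, hj, hij⟩ := h.exists_apply_ne_zero hM hi
      have hij1 : M i j = 1 := Fin.eq_one_of_ne_zero _ hij
      have hji : j ≠ i := by
        rintro rfl
        exact hij (hl0 j hj)
      have hN : offDiagPart (N + Matrix.single i i 1) = offDiagPart N := by
        ext a b
        simp only [offDiagPart, Matrix.add_apply, Matrix.single_apply]
        grind
      rw [← hN]
      refine .of_fullLC i <| loop (fullLC_isSymm hM i)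
        (h.fullLC_add_single hM hi (hl0 i hi)) j hj ?_
      simp [fullLC, vecMulVec_apply, neighborVec, hji, hl0 j hj, hij1]

end LocalComplementation

/-- **Theorem (Statement 3).** If `S` is a zero-diagonal symmetric matrix over `GF(2)`
and `T` is a modified inverse of `S`, then `S ∼_lc T`. -/
theorem lc_of_modifiedInverse {n : Type*} [Fintype n] [DecidableEq n]
    (S T : Matrix n n (ZMod 2))
    (hS : S.IsSymm) (hS0 : ∀ i, S i i = 0)
    (hT : IsModifiedInverse S T) : LCRel S T := by
  obtain ⟨A, hsymm, hunit, hoff, hT⟩ := hT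
  have hSoff : offDiagPart A = S := by
    ext j k
    by_cases hjk : j = k
    · subst hjk; simp [offDiagPart, hS0]
    · simp [offDiagPart, hjk, hoff]
  have hToff : offDiagPart A⁻¹ = T := by
    ext j k
    rw [hT, offDiagPart]
  have hpiv : IsPivot A A⁻¹ Finset.univ := fun x => by
    simp [mulVec_mulVec, nonsing_inv_mul _ ((isUnit_iff_isUnit_det A).mp hunit)]
  simpa only [hSoff, hToff] using hpiv.lcRel hsymm
end

section
/- Let S be a zero-diagonal symmetric matrix over GF(2) and i an index. If every entry of row i of S is 0, then S^i = S. If row i of S has a nonzero entry, then there exists a zero-diagonal symmetric matrix T over GF(2) such that T is a modified inverse of S and the simple local complement S^i is a modified inverse of T. In particular, every simple local complement of S can be obtained from S by at most two modified inversions. -/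
open Matrix

/-- If `M.det ≠ 0` and the rows of `M` indexed by `s` are standard basis rows, then those rows can
be replaced by the rows of `A`, up to adjusting diagonal entries, keeping the determinant nonzero. -/
theorem exists_diagonal_shift_det_ne_zero {n R : Type*} [Fintype n] [DecidableEq n] [CommRing R]
    (A M : Matrix n n R) (hM : M.det ≠ 0) (s : Finset n)
    (hs : ∀ k ∈ s, M k = Pi.single k 1) :
    ∃ d : n → R,
      (Matrix.of fun k => if k ∈ s then A k + Pi.single k (d k) else M k).det ≠ 0 := by
  induction s using Finset.induction_on with
  | empty => exact ⟨0, hM⟩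
  | insert k s hk ih =>
    obtain ⟨d, hd⟩ := ih fun l hl => hs l (Finset.mem_insert_of_mem hl)
    set N : Matrix n n R :=
      Matrix.of fun k => if k ∈ s then A k + Pi.single k (d k) else M k with hN
    have hNk : N k = Pi.single k 1 := by
      rw [← hs k (Finset.mem_insert_self k s)]
      exact if_neg hk
    have hupd (c : R) : (Matrix.of fun l => if l ∈ insert k s then
        A l + Pi.single l (Function.update d k c l) else M l) =
        N.updateRow k (A k + c • N k) := by
      ext l m
      rcases eq_or_ne l k with rfl | hl
      · rw [hNk]
        by_cases h : m = l <;> simp [h]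
      · simp [hN, hl]
    have hdet (c : R) : (N.updateRow k (A k + c • N k)).det =
        (N.updateRow k (A k)).det + c * N.det := by
      rw [det_updateRow_add, det_updateRow_smul, updateRow_eq_self]
    by_cases h0 : (N.updateRow k (A k)).det = 0
    · refine ⟨Function.update d k 1, ?_⟩
      rw [hupd, hdet, h0]
      simpa using hd
    · refine ⟨Function.update d k 0, ?_⟩
      rw [hupd, hdet]
      simpa using h0

/-- If row `i` of a zero-diagonal symmetric matrix is nonzero, then its diagonal entries away
from `i` can be changed so that it becomes invertible. -/
theorem exists_isUnit_add_diagonal {n F : Type*} [Fintype n] [DecidableEq n] [Field F]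
    (S : Matrix n n F) (hS : S.IsSymm) (hS0 : ∀ j, S j j = 0) {i j : n} (hij : S i j ≠ 0) :
    ∃ d : n → F, d i = 0 ∧ IsUnit (S + diagonal d) := by
  let s : Finset n := Finset.univ.filter fun k => k ≠ i ∧ k ≠ j
  let M : Matrix n n F := Matrix.of fun k => if k ∈ s then Pi.single k 1 else S k
  have hM : M.det ≠ 0 := by
    intro h
    obtain ⟨v, hv, hMv⟩ := exists_mulVec_eq_zero_iff.mpr h
    have hvk (k : n) (hki : k ≠ i) (hkj : k ≠ j) : v k = 0 := by
      have := congrFun hMv k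
      simpa [M, s, mulVec, hki, hkj] using this
    have hvj : v j = 0 := by
      have := congrFun hMv i
      simp only [M, s, mulVec, dotProduct, of_apply, Pi.zero_apply] at this
      rw [Finset.sum_eq_single j] at this
      · simpa [hij] using this
      · intro k _ hkj
        rcases eq_or_ne k i with rfl | hki
        · simp [hS0]
        · simp [hvk k hki hkj]
      · simp
    have hvi : v i = 0 := by
      have := congrFun hMv j
      simp only [M, s, mulVec, dotProduct, of_apply, Pi.zero_apply] at this
      rw [Finset.sum_eq_single i] at this
      · simpa [hS.apply i j, hij] using this
      · intro k _ hki
        rcases eq_or_ne k j with rfl | hkj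
        · simp [hvj]
        · simp [hvk k hki hkj]
      · simp
    refine hv (funext fun k => ?_)
    by_cases hki : k = i
    · simpa [hki] using hvi
    · by_cases hkj : k = j
      · simpa [hkj] using hvj
      · exact hvk k hki hkj
  obtain ⟨d, hd⟩ := exists_diagonal_shift_det_ne_zero S M hM s fun k hk => by
    ext
    simp [M, hk]
  refine ⟨fun k => if k ∈ s then d k else 0, by simp [s], ?_⟩
  rw [isUnit_iff_isUnit_det, isUnit_iff_ne_zero]
  convert hd using 2
  ext k l
  by_cases hk : k ∈ s <;>
    simp [M, hk, diagonal_apply, Pi.single_apply, eq_comm]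

/-- Toggling the diagonal entry `i` of the inverse of `A`, where `A i i = 0`, adds to `A` the
product of its column `i` and its row `i`. -/
theorem inv_add_single_mul_eq_one {n : Type*} [Fintype n] [DecidableEq n]
    (A : Matrix n n (ZMod 2)) (hA : IsUnit A) {i : n} (hi : A i i = 0) :
    (A⁻¹ + single i i 1) * (A + A * single i i 1 * A) = 1 := by
  have hinv : A⁻¹ * A = 1 := nonsing_inv_mul A ((isUnit_iff_isUnit_det A).mp hA)
  have hE : single i i 1 * A * single i i 1 = 0 := by
    simp [single_mul_mul_single, hi]
  have hexp : (A⁻¹ + single i i 1) * (A + A * single i i 1 * A) =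
      A⁻¹ * A + (A⁻¹ * A * single i i 1 * A + single i i 1 * A) +
        single i i 1 * A * single i i 1 * A := by
    noncomm_ring
  rw [hexp, hE, hinv, one_mul, zero_mul, add_zero]
  ext k l
  simp [CharTwo.add_self_eq_zero]

/-- **Theorem (Statement 4).** If row `i` of `S` is zero then `S^i = S`; if row `i`
has a nonzero entry then there is a zero-diagonal symmetric `T` which is a modified
inverse of `S` and such that `S^i` is a modified inverse of `T`.  In particular every
simple local complement of `S` is obtained from `S` by at most two modified inversions. -/
theorem slc_via_two_modifiedInverses {n : Type*} [Fintype n] [DecidableEq n]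
    (S : Matrix n n (ZMod 2))
    (hS : S.IsSymm) (hS0 : ∀ j, S j j = 0) (i : n) :
    ((∀ j, S i j = 0) → slc S i = S) ∧
    ((∃ j, S i j ≠ 0) → ∃ T : Matrix n n (ZMod 2), T.IsSymm ∧ (∀ j, T j j = 0) ∧
      IsModifiedInverse S T ∧ IsModifiedInverse T (slc S i)) := by
  refine ⟨fun h => ?_, fun ⟨j, hij⟩ => ?_⟩
  · ext j k
    simp [slc, h]
  obtain ⟨d, hdi, hU⟩ := exists_isUnit_add_diagonal S hS hS0 hij
  set A := S + diagonal d with hA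
  have hAsymm : A.IsSymm := hS.add (isSymm_diagonal d)
  have hAii : A i i = 0 := by simp [hA, hS0, hdi]
  have hAoff (j k : n) (hjk : j ≠ k) : A j k = S j k := by simp [hA, hjk]
  have hAinv : A⁻¹.IsSymm := by
    rw [IsSymm, transpose_nonsing_inv, hAsymm]
  have hmul := inv_add_single_mul_eq_one A hU hAii
  refine ⟨Matrix.of fun j k => if j = k then 0 else A⁻¹ j k, ?_, by simp,
    ⟨A, hAsymm, hU, hAoff, fun _ _ => rfl⟩,
    A⁻¹ + single i i 1, ?_, IsUnit.of_mul_eq_one _ hmul, ?_, ?_⟩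
  · ext j k
    simp [eq_comm, hAinv.apply j k]
  · exact hAinv.add (by simp [IsSymm])
  · intro j k hjk
    have : ¬(i = j ∧ i = k) := fun h => hjk (h.1.symm.trans h.2)
    simp [hjk, this]
  · intro j k
    rw [inv_eq_right_inv hmul]
    have hrank : (A * single i i (1 : ZMod 2) * A) j k = A j i * A i k := by
      simp [mul_apply, single_apply, ite_and]
    by_cases hjk : j = k
    · subst hjk
      simp [slc, hS0]
    rw [if_neg hjk, Matrix.add_apply, hrank, hAoff j k hjk]
    by_cases hj : i = j
    · subst hj
      simp [slc, hAii]
    by_cases hk : i = k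
    · subst hk
      simp [slc, hAii]
    simp [slc, hjk, hj, hk, hAoff j i (Ne.symm hj), hAoff i k hk, hS.apply i j]
end

section
/- Let M be a symmetric n×n matrix over GF(2), let ρ be an arbitrary row vector of length n with transpose κ, and let M₁ = [[M, κ],[ρ, 1]], M₂ = [[M, κ],[ρ, 0]], M₃ = [[M, 0],[0, 1]] be the indicated (n+1)×(n+1) symmetric matrices. Then two of M₁, M₂, M₃ have the same nullspace, say of dimension ν, and the nullspace of the remaining matrix has dimension ν+1 and contains the nullspace shared by the other two. -/
open Matrix

/-- The `(n+1) × (n+1)` matrix obtained by bordering `M` with the column vector `ρᵀ`,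
the row vector `ρ`, and the scalar `d` in the corner. -/
def border {n : ℕ} (M : Matrix (Fin n) (Fin n) (ZMod 2)) (ρ : Fin n → ZMod 2)
    (d : ZMod 2) : Matrix (Fin n ⊕ Unit) (Fin n ⊕ Unit) (ZMod 2) :=
  fun i j =>
    match i, j with
    | .inl a, .inl b => M a b
    | .inl a, .inr _ => ρ a
    | .inr _, .inl b => ρ b
    | .inr _, .inr _ => d

/-- The nullspace of a square matrix `N`: the space of row vectors `x` with `x · N = 0`. -/
def nsp {m : Type*} [Fintype m] (N : Matrix m m (ZMod 2)) :
    Submodule (ZMod 2) (m → ZMod 2) :=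
  LinearMap.ker N.vecMulLinear

/-- The nullity of a square matrix: the dimension of its nullspace. -/
noncomputable def nullity {m : Type*} [Fintype m] (N : Matrix m m (ZMod 2)) : ℕ :=
  Module.finrank (ZMod 2) (nsp N)

theorem mem_nsp_border {n : ℕ} {M : Matrix (Fin n) (Fin n) (ZMod 2)} {ρ : Fin n → ZMod 2}
    {d : ZMod 2} {x : Fin n ⊕ Unit → ZMod 2} :
    x ∈ nsp (border M ρ d) ↔
      (x ∘ Sum.inl) ᵥ* M + x (Sum.inr ()) • ρ = 0 ∧
        (x ∘ Sum.inl) ⬝ᵥ ρ + x (Sum.inr ()) * d = 0 := by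
  simp [nsp, funext_iff, vecMul, dotProduct, border]

theorem mem_nsp_border_zero_one {n : ℕ} {M : Matrix (Fin n) (Fin n) (ZMod 2)}
    {x : Fin n ⊕ Unit → ZMod 2} :
    x ∈ nsp (border M (fun _ => 0) 1) ↔ (x ∘ Sum.inl) ᵥ* M = 0 ∧ x (Sum.inr ()) = 0 := by
  have h : (fun _ => 0 : Fin n → ZMod 2) = 0 := rfl
  simp [mem_nsp_border, h]

theorem finrank_eq_add_one_of_sub_smul_mem {K V : Type*} [DivisionRing K] [AddCommGroup V]
    [Module K V] [Module.Finite K V] {p q : Submodule K V} (hpq : p ≤ q) {v : V} (hvq : v ∈ q)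
    (hvp : v ∉ p) (h : ∀ u ∈ q, ∃ c : K, u - c • v ∈ p) :
    Module.finrank K q = Module.finrank K p + 1 := by
  have hq : q = p ⊔ Submodule.span K {v} := by
    refine le_antisymm (fun u hu => ?_) (sup_le hpq (by simpa using hvq))
    obtain ⟨c, hc⟩ := h u hu
    exact Submodule.mem_sup.2
      ⟨_, hc, c • v, Submodule.smul_mem _ _ (Submodule.mem_span_singleton_self v), by simp⟩
  rw [hq, Submodule.finrank_sup_span_singleton hvp]

/-- A vector outside the row space of `M` is detected by a vector `z` with `M *ᵥ z = 0`. -/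
theorem exists_vecMul_eq_or_exists_mulVec_eq_zero {K m n : Type*} [Field K] [Fintype m] [Fintype n]
    (M : Matrix m n K) (ρ : n → K) :
    (∃ w, w ᵥ* M = ρ) ∨ ∃ z, M *ᵥ z = 0 ∧ z ⬝ᵥ ρ = 1 := by
  classical
  by_cases h : ρ ∈ LinearMap.range M.vecMulLinear
  · exact Or.inl h
  · right
    obtain ⟨f, hf, hle⟩ := Submodule.exists_le_ker_of_notMem h
    obtain ⟨z, rfl⟩ := (dotProductEquiv K n).surjective f
    simp only [dotProductEquiv_apply_apply] at hf
    refine ⟨(z ⬝ᵥ ρ)⁻¹ • z, ?_, by simp [hf]⟩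
    rw [mulVec_smul, smul_eq_zero]
    right
    refine dotProduct_eq_zero _ fun w => ?_
    have : z ⬝ᵥ (w ᵥ* M) = 0 := hle ⟨w, rfl⟩
    rw [dotProduct_comm, dotProduct_mulVec, dotProduct_comm, this]

theorem nsp_border_eq_of_dotProduct_ne {n : ℕ} {M : Matrix (Fin n) (Fin n) (ZMod 2)}
    (hM : M.IsSymm) {ρ w : Fin n → ZMod 2} (hw : w ᵥ* M = ρ) {d : ZMod 2} (hd : d ≠ w ⬝ᵥ ρ) :
    nsp (border M ρ d) = nsp (border M (fun _ => 0) 1) := by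
  have key (y : Fin n → ZMod 2) : y ⬝ᵥ ρ = w ⬝ᵥ (y ᵥ* M) := by
    rw [← hw, dotProduct_comm, ← dotProduct_mulVec, ← vecMul_transpose, hM.eq]
  ext x
  rw [mem_nsp_border, mem_nsp_border_zero_one]
  constructor
  · rintro ⟨h₁, h₂⟩
    have ht : x (Sum.inr ()) = 0 := by
      rw [key, eq_neg_of_add_eq_zero_left h₁, dotProduct_neg, dotProduct_smul, smul_eq_mul] at h₂
      have : x (Sum.inr ()) * (d - w ⬝ᵥ ρ) = 0 := by linear_combination h₂
      exact (mul_eq_zero.1 this).resolve_right (sub_ne_zero.2 hd)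
    exact ⟨by simpa [ht] using h₁, ht⟩
  · rintro ⟨h₁, ht⟩
    simp [key, h₁, ht]

theorem nsp_border_dotProduct {n : ℕ} {M : Matrix (Fin n) (Fin n) (ZMod 2)}
    (hM : M.IsSymm) {ρ w : Fin n → ZMod 2} (hw : w ᵥ* M = ρ) :
    nsp (border M (fun _ => 0) 1) ≤ nsp (border M ρ (w ⬝ᵥ ρ)) ∧
      nullity (border M ρ (w ⬝ᵥ ρ)) = nullity (border M (fun _ => 0) 1) + 1 := by
  have hle : nsp (border M (fun _ => 0) 1) ≤ nsp (border M ρ (w ⬝ᵥ ρ)) := by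
    rw [← nsp_border_eq_of_dotProduct_ne hM hw (d := w ⬝ᵥ ρ + 1) (by simp)]
    intro x hx
    have ht := (mem_nsp_border_zero_one.1
      (nsp_border_eq_of_dotProduct_ne hM hw (d := w ⬝ᵥ ρ + 1) (by simp) ▸ hx)).2
    rw [mem_nsp_border] at hx ⊢
    simpa [ht] using hx
  refine ⟨hle, finrank_eq_add_one_of_sub_smul_mem hle (v := Sum.elim w 1) ?_ ?_ ?_⟩
  · simp [mem_nsp_border, hw, CharTwo.add_self_eq_zero, funext_iff]
  · simp [mem_nsp_border_zero_one]
  · intro u hu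
    refine ⟨u (Sum.inr ()), mem_nsp_border_zero_one.2 ⟨?_, by simp⟩⟩
    have hcomp : (u - u (Sum.inr ()) • Sum.elim w 1) ∘ Sum.inl =
        u ∘ Sum.inl + u (Sum.inr ()) • w := by
      ext i; simp [CharTwo.sub_eq_add]
    rw [hcomp, add_vecMul, smul_vecMul, hw, (mem_nsp_border.1 hu).1]

theorem mem_nsp_border_of_mulVec_eq_zero {n : ℕ} {M : Matrix (Fin n) (Fin n) (ZMod 2)}
    {ρ z : Fin n → ZMod 2} (hz : M *ᵥ z = 0) (hzρ : z ⬝ᵥ ρ = 1) {d : ZMod 2}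
    {x : Fin n ⊕ Unit → ZMod 2} :
    x ∈ nsp (border M ρ d) ↔
      x ∈ nsp (border M (fun _ => 0) 1) ∧ (x ∘ Sum.inl) ⬝ᵥ ρ = 0 := by
  rw [mem_nsp_border, mem_nsp_border_zero_one]
  constructor
  · rintro ⟨h₁, h₂⟩
    have ht : x (Sum.inr ()) = 0 := by
      simpa [← dotProduct_mulVec, hz, dotProduct_comm ρ z, hzρ] using congrArg (· ⬝ᵥ z) h₁
    simp_all
  · rintro ⟨⟨h₁, ht⟩, h₂⟩
    simp [h₁, ht, h₂]

theorem nullity_border_of_mulVec_eq_zero {n : ℕ} {M : Matrix (Fin n) (Fin n) (ZMod 2)}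
    (hM : M.IsSymm) {ρ z : Fin n → ZMod 2} (hz : M *ᵥ z = 0) (hzρ : z ⬝ᵥ ρ = 1) (d : ZMod 2) :
    nullity (border M (fun _ => 0) 1) = nullity (border M ρ d) + 1 := by
  have hv : Sum.elim z 0 ∈ nsp (border M (fun _ => 0) 1) := by
    rw [mem_nsp_border_zero_one]
    simpa [← mulVec_transpose, hM.eq] using hz
  refine finrank_eq_add_one_of_sub_smul_mem
    (fun x hx => ((mem_nsp_border_of_mulVec_eq_zero hz hzρ).1 hx).1) hv ?_ fun u hu => ?_
  · simp [mem_nsp_border_of_mulVec_eq_zero hz hzρ, hzρ]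
  · refine ⟨(u ∘ Sum.inl) ⬝ᵥ ρ, (mem_nsp_border_of_mulVec_eq_zero hz hzρ).2
      ⟨sub_mem hu (Submodule.smul_mem _ _ hv), ?_⟩⟩
    have hcomp (c : ZMod 2) :
        (u - c • Sum.elim z 0) ∘ Sum.inl = u ∘ Sum.inl - c • z := by
      ext i; simp
    simp [hcomp, sub_dotProduct, hzρ]

/-- **Theorem (Statement 5, the ν,ν,ν+1 lemma).** Two of `M₁, M₂, M₃` have the same
nullspace, say of dimension `ν`; the nullspace of the remaining matrix has dimension
`ν + 1` and contains the nullspace shared by the other two. -/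
theorem nu_nu_nu_plus_one {n : ℕ} (M : Matrix (Fin n) (Fin n) (ZMod 2))
    (hM : M.IsSymm) (ρ : Fin n → ZMod 2) :
    (nsp (border M ρ 1) = nsp (border M ρ 0) ∧
      nsp (border M ρ 1) ≤ nsp (border M (fun _ => 0) 1) ∧
      nullity (border M (fun _ => 0) 1) = nullity (border M ρ 1) + 1) ∨
    (nsp (border M ρ 1) = nsp (border M (fun _ => 0) 1) ∧
      nsp (border M ρ 1) ≤ nsp (border M ρ 0) ∧
      nullity (border M ρ 0) = nullity (border M ρ 1) + 1) ∨
    (nsp (border M ρ 0) = nsp (border M (fun _ => 0) 1) ∧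
      nsp (border M ρ 0) ≤ nsp (border M ρ 1) ∧
      nullity (border M ρ 1) = nullity (border M ρ 0) + 1) := by
  obtain ⟨w, hw⟩ | ⟨z, hz, hzρ⟩ := exists_vecMul_eq_or_exists_mulVec_eq_zero M ρ
  · right
    obtain ⟨hle, hnull⟩ := nsp_border_dotProduct hM hw
    have hcases : ∀ c : ZMod 2, c = 0 ∨ c = 1 := by decide
    obtain hc | hc := hcases (w ⬝ᵥ ρ)
    · left
      have heq := nsp_border_eq_of_dotProduct_ne hM hw (d := 1) (by simp [hc])
      rw [hc] at hle hnull
      exact ⟨heq, heq ▸ hle, by rw [hnull, nullity, nullity, heq]⟩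
    · right
      have heq := nsp_border_eq_of_dotProduct_ne hM hw (d := 0) (by simp [hc])
      rw [hc] at hle hnull
      exact ⟨heq, heq ▸ hle, by rw [hnull, nullity, nullity, heq]⟩
  · left
    refine ⟨?_, fun x hx => ((mem_nsp_border_of_mulVec_eq_zero hz hzρ).1 hx).1,
      nullity_border_of_mulVec_eq_zero hM hz hzρ 1⟩
    ext x
    simp only [mem_nsp_border_of_mulVec_eq_zero hz hzρ]
end

section
/- Let M be a symmetric n×n matrix over GF(2), let ρ be a row vector of length n with transpose κ, and let M₁ = [[M, κ],[ρ, 1]], M₂ = [[M, κ],[ρ, 0]], M₃ = [[M, 0],[0, 1]]. Suppose ρ does not lie in the row space of M. Then ν(M₁) = ν(M₂) = ν(M) − 1 = ν(M₃) − 1, ker M₁ = ker M₂ = { (y, 0) : y ∈ ker M and y·κ = 0 }, and ker M₃ = { (y, 0) : y ∈ ker M }, so ker M₃ strictly contains ker M₁ = ker M₂. -/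
open Matrix

theorem mem_nsp {m : Type*} [Fintype m] {N : Matrix m m (ZMod 2)} {x : m → ZMod 2} :
    x ∈ nsp N ↔ x ᵥ* N = 0 :=
  Iff.rfl

theorem border_eq_fromBlocks {n : ℕ} (M : Matrix (Fin n) (Fin n) (ZMod 2))
    (ρ : Fin n → ZMod 2) (d : ZMod 2) :
    border M ρ d = fromBlocks M (replicateCol Unit ρ) (replicateRow Unit ρ) (of fun _ _ => d) := by
  ext (i | i) (j | j) <;> rfl

theorem sumElim_mem_nsp_border {n : ℕ} {M : Matrix (Fin n) (Fin n) (ZMod 2)}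
    {ρ y : Fin n → ZMod 2} {d : ZMod 2} {t : Unit → ZMod 2} :
    Sum.elim y t ∈ nsp (border M ρ d) ↔ y ᵥ* M + t () • ρ = 0 ∧ y ⬝ᵥ ρ + t () * d = 0 := by
  rw [mem_nsp, border_eq_fromBlocks, vecMul_fromBlocks]
  simp [funext_iff, vecMul, dotProduct]

/-- If `ρ` is not in the row space of `M`, the last entry of any null vector of the bordered
matrix vanishes. -/
theorem mem_nsp_border_iff {n : ℕ} {M : Matrix (Fin n) (Fin n) (ZMod 2)} {ρ : Fin n → ZMod 2}
    (hρ : ρ ∉ LinearMap.range M.vecMulLinear) (d : ZMod 2) (x : Fin n ⊕ Unit → ZMod 2) :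
    x ∈ nsp (border M ρ d) ↔ ∃ y ∈ nsp M, y ⬝ᵥ ρ = 0 ∧ x = Sum.elim y 0 := by
  constructor
  · intro hx
    obtain ⟨y, t, rfl⟩ : ∃ y t, x = Sum.elim y t :=
      ⟨x ∘ Sum.inl, x ∘ Sum.inr, (Sum.elim_comp_inl_inr x).symm⟩
    rw [sumElim_mem_nsp_border] at hx
    have ht : t () = 0 := by
      by_contra ht
      refine hρ ((Submodule.smul_mem_iff _ ht).1 ?_)
      rw [eq_neg_of_add_eq_zero_right hx.1]
      exact neg_mem ⟨y, rfl⟩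
    rw [ht, zero_smul, zero_mul, add_zero, add_zero] at hx
    exact ⟨y, hx.1, hx.2, congrArg _ (funext fun _ => ht)⟩
  · rintro ⟨y, hy, hyρ, rfl⟩
    simpa [sumElim_mem_nsp_border, hyρ] using mem_nsp.1 hy

theorem mem_nsp_border_zero_iff {n : ℕ} (M : Matrix (Fin n) (Fin n) (ZMod 2))
    (x : Fin n ⊕ Unit → ZMod 2) :
    x ∈ nsp (border M (fun _ => 0) 1) ↔ ∃ y ∈ nsp M, x = Sum.elim y 0 := by
  constructor
  · intro hx
    obtain ⟨y, t, rfl⟩ : ∃ y t, x = Sum.elim y t :=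
      ⟨x ∘ Sum.inl, x ∘ Sum.inr, (Sum.elim_comp_inl_inr x).symm⟩
    rw [sumElim_mem_nsp_border] at hx
    have ht : t () = 0 := by simpa [dotProduct] using hx.2
    refine ⟨y, ?_, congrArg _ (funext fun _ => ht)⟩
    simpa [ht, mem_nsp] using hx.1
  · rintro ⟨y, hy, rfl⟩
    simpa [sumElim_mem_nsp_border, dotProduct] using mem_nsp.1 hy

theorem exists_mem_nsp_dotProduct_ne_zero {m : Type*} [Fintype m] {M : Matrix m m (ZMod 2)}
    (hM : M.IsSymm) {ρ : m → ZMod 2} (hρ : ρ ∉ LinearMap.range M.vecMulLinear) :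
    ∃ y ∈ nsp M, y ⬝ᵥ ρ ≠ 0 := by
  classical
  obtain ⟨f, hfρ, hf⟩ := Submodule.exists_le_ker_of_notMem hρ
  obtain ⟨y, rfl⟩ := (dotProductEquiv (ZMod 2) m).surjective f
  refine ⟨y, ?_, hfρ⟩
  rw [mem_nsp, ← mulVec_transpose, hM.eq, ← dotProduct_eq_zero_iff]
  intro v
  rw [dotProduct_comm, dotProduct_mulVec, dotProduct_comm]
  exact hf ⟨v, rfl⟩

/-- The embedding `y ↦ (y, 0)`. -/
def appendZero (n : ℕ) : (Fin n → ZMod 2) →ₗ[ZMod 2] (Fin n ⊕ Unit → ZMod 2) where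
  toFun y := Sum.elim y 0
  map_add' y z := by ext (i | i) <;> simp
  map_smul' c y := by ext (i | i) <;> simp

theorem appendZero_injective (n : ℕ) : Function.Injective (appendZero n) :=
  fun _ _ h => funext fun i => congrFun h (Sum.inl i)

theorem nullity_border_zero {n : ℕ} (M : Matrix (Fin n) (Fin n) (ZMod 2)) :
    nullity (border M (fun _ => 0) 1) = nullity M := by
  have h : nsp (border M (fun _ => 0) 1) = (nsp M).map (appendZero n) := by
    ext x
    simp [mem_nsp_border_zero_iff, appendZero, eq_comm]
  rw [nullity, h]
  exact (Submodule.equivMapOfInjective _ (appendZero_injective n) _).symm.finrank_eq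

theorem nullity_border_add_one {n : ℕ} {M : Matrix (Fin n) (Fin n) (ZMod 2)} (hM : M.IsSymm)
    {ρ : Fin n → ZMod 2} (hρ : ρ ∉ LinearMap.range M.vecMulLinear) (d : ZMod 2) :
    nullity (border M ρ d) + 1 = nullity M := by
  let φ : Module.Dual (ZMod 2) (nsp M) := (dotProductEquiv (ZMod 2) (Fin n) ρ).domRestrict (nsp M)
  have hφ : φ ≠ 0 := by
    obtain ⟨y, hy, hyρ⟩ := exists_mem_nsp_dotProduct_ne_zero hM hρ
    intro h
    exact hyρ ((dotProduct_comm _ _).trans (LinearMap.congr_fun h ⟨y, hy⟩))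
  have h : nsp (border M ρ d) = (LinearMap.ker φ).map (appendZero n ∘ₗ (nsp M).subtype) := by
    ext x
    simp [mem_nsp_border_iff hρ, appendZero, φ, dotProduct_comm, eq_comm, and_left_comm]
  have hinj : Function.Injective (appendZero n ∘ₗ (nsp M).subtype) :=
    (appendZero_injective n).comp (nsp M).injective_subtype
  rw [nullity, h, ← (Submodule.equivMapOfInjective _ hinj _).finrank_eq]
  exact Module.Dual.finrank_ker_add_one_of_ne_zero hφ

/-- **Theorem (Statement 6, Case 1 of the ν,ν,ν+1 lemma).** If `ρ` is not in the row
space of `M`, then `ν(M₁) = ν(M₂) = ν(M) − 1 = ν(M₃) − 1`,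
`ker M₁ = ker M₂ = {(y,0) : y ∈ ker M, y·κ = 0}`, `ker M₃ = {(y,0) : y ∈ ker M}`,
and `ker M₃` strictly contains `ker M₁ = ker M₂`. -/
theorem nu_lemma_case_one {n : ℕ} (M : Matrix (Fin n) (Fin n) (ZMod 2))
    (hM : M.IsSymm) (ρ : Fin n → ZMod 2)
    (hρ : ρ ∉ LinearMap.range M.vecMulLinear) :
    nullity (border M ρ 1) = nullity (border M ρ 0) ∧
    nullity (border M ρ 1) + 1 = nullity M ∧
    nullity (border M (fun _ => 0) 1) = nullity M ∧
    nsp (border M ρ 1) = nsp (border M ρ 0) ∧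
    (∀ x, x ∈ nsp (border M ρ 1) ↔
      ∃ y ∈ nsp M, y ⬝ᵥ ρ = 0 ∧ x = Sum.elim y 0) ∧
    (∀ x, x ∈ nsp (border M (fun _ => 0) 1) ↔ ∃ y ∈ nsp M, x = Sum.elim y 0) ∧
    nsp (border M ρ 1) < nsp (border M (fun _ => 0) 1) := by
  have h1 := nullity_border_add_one hM hρ 1
  have h0 := nullity_border_add_one hM hρ 0
  refine ⟨by omega, h1, nullity_border_zero M, ?_, mem_nsp_border_iff hρ 1,
    mem_nsp_border_zero_iff M, ?_⟩
  · ext x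
    rw [mem_nsp_border_iff hρ, mem_nsp_border_iff hρ]
  · refine lt_of_le_of_ne (fun x hx => ?_) fun h => ?_
    · obtain ⟨y, hy, -, rfl⟩ := (mem_nsp_border_iff hρ 1 x).1 hx
      exact (mem_nsp_border_zero_iff M _).2 ⟨y, hy, rfl⟩
    · have h3 := nullity_border_zero M
      rw [nullity, ← h, ← nullity] at h3
      omega
end

section
/- Let S be an n×n zero-diagonal symmetric matrix over GF(2) and let i be an index such that row i of S has at least one nonzero entry. Then there is an invertible symmetric matrix M over GF(2) that differs from S only in diagonal entries other than the i-th (in particular M_{ii} = 0 and M agrees with S off the diagonal). -/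
open Matrix

/-- If the matrix obtained from `A` by replacing the rows indexed by `U` with the corresponding
rows of the identity is nonsingular, then `A` can be made nonsingular by changing only its diagonal
entries in `U`. -/
lemma Matrix.exists_det_add_diagonal_ne_zero {n F : Type*} [Fintype n] [DecidableEq n] [Field F]
    (U : Finset n) (A : Matrix n n F)
    (hA : (of fun k => if k ∈ U then Pi.single k 1 else A k : Matrix n n F).det ≠ 0) :
    ∃ d : n → F, (∀ k ∉ U, d k = 0) ∧ (A + diagonal d).det ≠ 0 := by
  induction U using Finset.induction_on generalizing A with
  | empty => exact ⟨0, by simp, by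
      have hof : (of fun k => A k) = A := rfl
      simpa [hof] using hA⟩
  | insert k U hk ih =>
    set B : Matrix n n F := of fun l => if l ∈ insert k U then Pi.single l 1 else A l with hB
    have hrow (c : F) : (of fun l => if l ∈ U then Pi.single l 1
        else (A + diagonal (Pi.single k c)) l : Matrix n n F) =
        B.updateRow k (A k + c • Pi.single k 1) := by
      ext l m
      by_cases hl : l = k
      · subst hl
        by_cases hm : l = m
        · subst hm; simp [hk]
        · simp [hk, hm, Ne.symm hm]
      · by_cases hlU : l ∈ U
        · simp [hB, hl, hlU]
        · simp [hB, hl, hlU, diagonal_apply]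
    have hBk : B.updateRow k (Pi.single k 1) = B := by
      have hrowk : B k = Pi.single k 1 := by ext; simp [hB]
      rw [← hrowk, updateRow_eq_self]
    have hdet (c : F) : (of fun l => if l ∈ U then Pi.single l 1
        else (A + diagonal (Pi.single k c)) l : Matrix n n F).det =
        (B.updateRow k (A k)).det + c * B.det := by
      rw [hrow, det_updateRow_add, det_updateRow_smul, hBk]
    obtain ⟨c, hc⟩ : ∃ c : F, (B.updateRow k (A k)).det + c * B.det ≠ 0 := by
      by_cases h : (B.updateRow k (A k)).det = 0
      · exact ⟨1, by simpa [h] using hA⟩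
      · exact ⟨0, by simpa using h⟩
    obtain ⟨d, hd, hAd⟩ := ih _ (hdet c ▸ hc)
    refine ⟨Pi.single k c + d, fun l hl => ?_, ?_⟩
    · simp only [Finset.mem_insert, not_or] at hl
      simp [hl.1, hd l hl.2]
    · rwa [add_assoc, diagonal_add] at hAd

/-- **Theorem (Statement 8).** If `S` is a zero-diagonal symmetric matrix over `GF(2)`
and row `i` of `S` has a nonzero entry, then there is an invertible symmetric matrix
`M` differing from `S` only in diagonal entries other than the `i`-th. -/
theorem exists_invertible_diagonal_toggle {n : Type*} [Fintype n] [DecidableEq n]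
    (S : Matrix n n (ZMod 2)) (hS : S.IsSymm) (hS0 : ∀ j, S j j = 0)
    (i : n) (hi : ∃ j, S i j ≠ 0) :
    ∃ M : Matrix n n (ZMod 2), M.IsSymm ∧ IsUnit M ∧
      (∀ j k, j ≠ k → M j k = S j k) ∧ M i i = 0 := by
  obtain ⟨j, hj⟩ := hi
  have hij : i ≠ j := by rintro rfl; exact hj (hS0 i)
  have hji : S j i ≠ 0 := by rwa [hS.apply]
  obtain ⟨d, hd, hdet⟩ := exists_det_add_diagonal_ne_zero ({i, j} : Finset n)ᶜ S (by
    rw [Ne, ← exists_mulVec_eq_zero_iff]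
    rintro ⟨v, hv, h⟩
    have hout (k : n) (hki : k ≠ i) (hkj : k ≠ j) : v k = 0 := by
      simpa [mulVec, hki, hkj] using congrFun h k
    have hvj : v j = 0 := by
      have := congrFun h i
      simp only [mulVec, of_apply, dotProduct] at this
      rw [Finset.sum_eq_single j] at this
      · simpa [hj] using this
      · intro k _ hkj
        by_cases hki : k = i
        · subst hki; simp [hS0]
        · simp [hout k hki hkj]
      · simp
    have hvi : v i = 0 := by
      have := congrFun h j
      simp only [mulVec, of_apply, dotProduct] at this
      rw [Finset.sum_eq_single i] at this
      · simpa [hji] using this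
      · intro k _ hki
        by_cases hkj : k = j
        · subst hkj; simp [hvj]
        · simp [hout k hki hkj]
      · simp
    refine hv (funext fun k => ?_)
    by_cases hki : k = i
    · exact hki ▸ hvi
    by_cases hkj : k = j
    · exact hkj ▸ hvj
    exact hout k hki hkj)
  refine ⟨S + diagonal d, hS.add (isSymm_diagonal d), ?_, fun k l hkl => ?_, ?_⟩
  · exact (isUnit_iff_isUnit_det _).2 hdet.isUnit
  · simp [hkl]
  · simp [hS0, hd i]
end

section
/- Let M be an invertible symmetric matrix over GF(2) and let i be an index with M_{ii} = 0. Let M′ be the matrix defined by M′_{jk} = M_{jk} + M_{ij}·M_{ik} for all j, k ≠ i (including j = k), and with row i and column i equal to those of M. Then M′ is invertible, and (M′)^{-1} agrees with M^{-1} in every entry except the (i,i) entry, which is toggled: ((M′)^{-1})_{ii} = (M^{-1})_{ii} + 1. -/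
open Matrix

/-- The non-simple local complement of `M` at `i`: toggle `M j k` whenever
`j ≠ i ≠ k` (including `j = k`) and `M i j ≠ 0 ≠ M i k`; row `i` and column `i`
are unchanged. -/
def nslc {n : Type*} [DecidableEq n] (M : Matrix n n (ZMod 2)) (i : n) :
    Matrix n n (ZMod 2) :=
  fun j k => if j ≠ i ∧ k ≠ i then M j k + M i j * M i k else M j k

/-- A symmetric matrix with `M i i = 0` changes under local complementation at `i` by the
rank-one matrix `M * single i i 1 * M`. -/
theorem nslc_eq_add_mul_single_mul {n : Type*} [Fintype n] [DecidableEq n]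
    {M : Matrix n n (ZMod 2)} (hM : M.IsSymm) {i : n} (hii : M i i = 0) :
    nslc M i = M + M * single i i 1 * M := by
  ext j k
  have h : (M * single i i (1 : ZMod 2) * M) j k = M i j * M i k := by
    rw [mul_apply, Finset.sum_eq_single i]
    · simp [hM.apply i j]
    · intro b _ hb
      simp [hb]
    · simp
  rw [Matrix.add_apply, h, nslc]
  split_ifs with hjk
  · rfl
  · rcases not_and_or.mp hjk with hj | hk
    · simp [not_not.mp hj, hii]
    · simp [not_not.mp hk, hii]

/-- The product of the local complement at `i` with the inverse whose `(i, i)` entry is toggled. -/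
theorem nslc_mul_inv_add_single {n : Type*} [Fintype n] [DecidableEq n]
    {M : Matrix n n (ZMod 2)} (hM : M.IsSymm) (hunit : IsUnit M)
    {i : n} (hii : M i i = 0) :
    nslc M i * (M⁻¹ + single i i 1) = 1 := by
  have hinv : M * M⁻¹ = 1 := mul_nonsing_inv M ((isUnit_iff_isUnit_det M).mp hunit)
  have : Nonempty n := ⟨i⟩
  have hsandwich : single i i (1 : ZMod 2) * M * single i i 1 = 0 := by
    simp [single_mul_mul_single, hii]
  calc nslc M i * (M⁻¹ + single i i 1)
      = M * M⁻¹ + (M * single i i 1 + M * single i i 1 * (M * M⁻¹))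
          + M * (single i i 1 * M * single i i 1) := by
        rw [nslc_eq_add_mul_single_mul hM hii]
        noncomm_ring
    _ = 1 := by
        rw [hsandwich, hinv, mul_one, CharTwo.add_self_eq_zero, mul_zero, add_zero, add_zero]

/-- **Theorem (Statement 9).** If `M` is an invertible symmetric matrix over `GF(2)`
with `M i i = 0`, then the non-simple local complement `M′` of `M` at `i` is
invertible, and `(M′)⁻¹` agrees with `M⁻¹` except that its `(i,i)` entry is
toggled. -/
theorem nslc_inverse_toggles_diagonal {n : Type*} [Fintype n] [DecidableEq n]
    (M : Matrix n n (ZMod 2)) (hM : M.IsSymm) (hunit : IsUnit M)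
    (i : n) (hii : M i i = 0) :
    IsUnit (nslc M i) ∧
      ∀ j k, (nslc M i)⁻¹ j k =
        if j = i ∧ k = i then M⁻¹ j k + 1 else M⁻¹ j k := by
  have hmul := nslc_mul_inv_add_single hM hunit hii
  refine ⟨IsUnit.of_mul_eq_one _ hmul, fun j k => ?_⟩
  rw [inv_eq_right_inv hmul, Matrix.add_apply, single_apply]
  by_cases h : j = i ∧ k = i
  · simp [h]
  · have h' : ¬(i = j ∧ i = k) := fun h' => h ⟨h'.1.symm, h'.2.symm⟩
    simp [h, h']
end

section
/- Let M be an n×n matrix over a field, and let X₁, X₂ be subsets of the index set such that the principal pivot transform M∗X₁ is defined and (M∗X₁)∗X₂ is defined. Then M∗(X₁ Δ X₂) is defined (where Δ denotes symmetric difference) and (M∗X₁)∗X₂ = M∗(X₁ Δ X₂). -/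
open Matrix

section PPT

variable {F : Type*} [Field F] {n : Type*} [Fintype n] [DecidableEq n]

/-- The principal pivot transform `M ∗ X`: writing `M = [[P, Q], [R, S]]` in block
form with respect to the partition of the index set into `X` and its complement
(where `P = M[X,X]`), the principal pivot transform is
`M ∗ X = [[P⁻¹, −P⁻¹Q], [RP⁻¹, S − RP⁻¹Q]]`. -/
noncomputable def ppt (M : Matrix n n F) (X : Finset n) : Matrix n n F :=
  letI P : Matrix {x // x ∈ X} {x // x ∈ X} F := M.submatrix Subtype.val Subtype.val
  letI Q : Matrix {x // x ∈ X} {x // x ∈ Xᶜ} F := M.submatrix Subtype.val Subtype.val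
  letI R : Matrix {x // x ∈ Xᶜ} {x // x ∈ X} F := M.submatrix Subtype.val Subtype.val
  letI S : Matrix {x // x ∈ Xᶜ} {x // x ∈ Xᶜ} F := M.submatrix Subtype.val Subtype.val
  fun i j =>
    if hi : i ∈ X then
      if hj : j ∈ X then P⁻¹ ⟨i, hi⟩ ⟨j, hj⟩
      else (-(P⁻¹ * Q)) ⟨i, hi⟩ ⟨j, Finset.mem_compl.mpr hj⟩
    else
      if hj : j ∈ X then (R * P⁻¹) ⟨i, Finset.mem_compl.mpr hi⟩ ⟨j, hj⟩
      else (S - R * P⁻¹ * Q) ⟨i, Finset.mem_compl.mpr hi⟩ ⟨j, Finset.mem_compl.mpr hj⟩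

/-- `M ∗ X` is defined exactly when the principal submatrix `M[X,X]` is invertible. -/
def PptDefined (M : Matrix n n F) (X : Finset n) : Prop :=
  IsUnit (M.submatrix (Subtype.val : {x // x ∈ X} → n) (Subtype.val : {x // x ∈ X} → n))

end PPT

section PrincipalPivot

variable {F : Type*} {n : Type*} [DecidableEq n]

/-- Replace the coordinates of `x` that lie in `X` by those of `y`. -/
def exchange (X : Finset n) (x y : n → F) : n → F := fun i => if i ∈ X then y i else x i

/-- The block of `M` with rows in `X` and columns in `Y`. -/
def block (M : Matrix n n F) (X Y : Finset n) : Matrix {x // x ∈ X} {x // x ∈ Y} F :=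
  M.submatrix Subtype.val Subtype.val

/-- The restriction of a vector to the coordinates in `X`. -/
def restr (X : Finset n) (x : n → F) : {x // x ∈ X} → F := fun i => x i

lemma exchange_exchange (X : Finset n) (x y : n → F) :
    exchange X (exchange X x y) (exchange X y x) = x := by
  funext i
  by_cases h : i ∈ X <;> simp [exchange, h]

lemma exchange_symmDiff (X Y : Finset n) (x y : n → F) :
    exchange Y (exchange X x y) (exchange X y x) = exchange (symmDiff X Y) x y := by
  funext i
  by_cases h : i ∈ X <;> by_cases h' : i ∈ Y <;> simp [exchange, Finset.mem_symmDiff, h, h']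

lemma restr_exchange (X : Finset n) (x y : n → F) : restr X (exchange X x y) = restr X y := by
  funext i
  simp [restr, exchange]

variable [Fintype n]

lemma restr_compl_exchange (X : Finset n) (x y : n → F) :
    restr Xᶜ (exchange X x y) = restr Xᶜ x := by
  funext i
  simp [restr, exchange, Finset.mem_compl.mp i.2]

lemma eq_iff_restr (X : Finset n) (x y : n → F) :
    x = y ↔ restr X x = restr X y ∧ restr Xᶜ x = restr Xᶜ y := by
  refine ⟨by rintro rfl; exact ⟨rfl, rfl⟩, fun ⟨h, h'⟩ => funext fun i => ?_⟩
  by_cases hi : i ∈ X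
  · exact congrFun h ⟨i, hi⟩
  · exact congrFun h' ⟨i, Finset.mem_compl.mpr hi⟩

variable [Field F]

lemma restr_mulVec (M : Matrix n n F) (X Y : Finset n) (x : n → F) :
    restr Y (M *ᵥ x) = block M Y X *ᵥ restr X x + block M Y Xᶜ *ᵥ restr Xᶜ x := by
  funext i
  simp only [restr, block, Matrix.mulVec, dotProduct, Pi.add_apply, Matrix.submatrix_apply]
  rw [Finset.sum_coe_sort X fun j => M i j * x j, Finset.sum_coe_sort Xᶜ fun j => M i j * x j,
    Finset.sum_add_sum_compl]

lemma block_ppt_self (M : Matrix n n F) (X : Finset n) :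
    block (ppt M X) X X = (block M X X)⁻¹ := by
  ext i j
  simp [block, ppt]

lemma block_ppt_compl_right (M : Matrix n n F) (X : Finset n) :
    block (ppt M X) X Xᶜ = -((block M X X)⁻¹ * block M X Xᶜ) := by
  ext i j
  simp [block, ppt, Finset.mem_compl.mp j.2]

lemma block_ppt_compl_left (M : Matrix n n F) (X : Finset n) :
    block (ppt M X) Xᶜ X = block M Xᶜ X * (block M X X)⁻¹ := by
  ext i j
  simp [block, ppt, Finset.mem_compl.mp i.2]

lemma block_ppt_compl_compl (M : Matrix n n F) (X : Finset n) :
    block (ppt M X) Xᶜ Xᶜ =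
      block M Xᶜ Xᶜ - block M Xᶜ X * (block M X X)⁻¹ * block M X Xᶜ := by
  ext i j
  simp [block, ppt, Finset.mem_compl.mp i.2, Finset.mem_compl.mp j.2]

/-- The principal pivot transform exchanges inputs and outputs on `X`. -/
lemma ppt_mulVec_exchange_iff {M : Matrix n n F} {X : Finset n} (h : PptDefined M X)
    (x y : n → F) : ppt M X *ᵥ exchange X x y = exchange X y x ↔ M *ᵥ x = y := by
  have hdet : IsUnit (block M X X).det := (Matrix.isUnit_iff_isUnit_det _).mp h
  rw [eq_iff_restr X, eq_iff_restr X (M *ᵥ x), restr_mulVec _ X X, restr_mulVec _ X Xᶜ,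
    restr_mulVec _ X X, restr_mulVec _ X Xᶜ]
  simp only [restr_exchange, restr_compl_exchange, block_ppt_self, block_ppt_compl_right,
    block_ppt_compl_left, block_ppt_compl_compl]
  generalize restr X x = x₁, restr Xᶜ x = x₂, restr X y = y₁, restr Xᶜ y = y₂
  have hsolve : (block M X X)⁻¹ *ᵥ y₁ + -((block M X X)⁻¹ * block M X Xᶜ) *ᵥ x₂ = x₁ ↔
      block M X X *ᵥ x₁ + block M X Xᶜ *ᵥ x₂ = y₁ := by
    constructor
    · rintro rfl
      simp [Matrix.mulVec_add, Matrix.neg_mulVec, Matrix.mulVec_neg, Matrix.mulVec_mulVec,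
        ← Matrix.mul_assoc, Matrix.mul_nonsing_inv _ hdet]
    · rintro rfl
      simp [Matrix.mulVec_add, Matrix.neg_mulVec, Matrix.mulVec_mulVec,
        Matrix.nonsing_inv_mul _ hdet]
  rw [hsolve]
  refine and_congr_right fun hy => ?_
  rw [← hsolve] at hy
  rw [← hy]
  simp only [Matrix.mulVec_add, Matrix.neg_mulVec, Matrix.mulVec_neg, Matrix.mulVec_mulVec,
    Matrix.sub_mulVec, Matrix.mul_assoc]
  rw [add_assoc, neg_add_eq_sub]

lemma pptDefined_of_exchange_eq_zero {M : Matrix n n F} {X : Finset n}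
    (h : ∀ x, exchange X x (M *ᵥ x) = 0 → x = 0) : PptDefined M X := by
  change IsUnit (block M X X)
  rw [← Matrix.mulVec_injective_iff_isUnit, ← Matrix.coe_mulVecLin,
    injective_iff_map_eq_zero]
  intro v hv
  rw [Matrix.mulVecLin_apply] at hv
  let x : n → F := fun i => if hi : i ∈ X then v ⟨i, hi⟩ else 0
  have hx₁ : restr X x = v := by
    funext i
    simp [restr, x]
  have hx₂ : restr Xᶜ x = 0 := by
    funext i
    simp [restr, x, Finset.mem_compl.mp i.2]
  have hx : x = 0 := by
    refine h x ((eq_iff_restr X _ _).mpr ⟨?_, ?_⟩)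
    · rw [restr_exchange, restr_mulVec _ X, hx₁, hx₂, hv, Matrix.mulVec_zero, add_zero]
      rfl
    · rw [restr_compl_exchange, hx₂]
      rfl
  rw [← hx₁, hx]
  rfl

end PrincipalPivot

/-- **Theorem (Statement 10).** If `M ∗ X₁` and `(M ∗ X₁) ∗ X₂` are defined, then
`M ∗ (X₁ Δ X₂)` is defined and equals `(M ∗ X₁) ∗ X₂`. -/
theorem ppt_ppt {F : Type*} [Field F] {n : Type*} [Fintype n] [DecidableEq n]
    (M : Matrix n n F) (X₁ X₂ : Finset n)
    (h₁ : PptDefined M X₁) (h₂ : PptDefined (ppt M X₁) X₂) :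
    PptDefined M (symmDiff X₁ X₂) ∧ ppt (ppt M X₁) X₂ = ppt M (symmDiff X₁ X₂) := by
  have key (x y : n → F) : ppt (ppt M X₁) X₂ *ᵥ exchange (symmDiff X₁ X₂) x y =
      exchange (symmDiff X₁ X₂) y x ↔ M *ᵥ x = y := by
    rw [← exchange_symmDiff, ← exchange_symmDiff, ppt_mulVec_exchange_iff h₂,
      ppt_mulVec_exchange_iff h₁]
  have hdef : PptDefined M (symmDiff X₁ X₂) := by
    refine pptDefined_of_exchange_eq_zero fun x hx => ?_
    have hy := (key x _).mpr rfl
    rw [hx, Matrix.mulVec_zero] at hy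
    rw [← exchange_exchange (symmDiff X₁ X₂) x (M *ᵥ x), hx, ← hy]
    funext i
    simp [exchange]
  refine ⟨hdef, Matrix.ext_of_mulVec_single fun i => ?_⟩
  generalize (Pi.single i 1 : n → F) = v
  generalize hw : ppt (ppt M X₁) X₂ *ᵥ v = w
  have hM := (key (exchange _ v w) (exchange _ w v)).mp
    (by rw [exchange_exchange, exchange_exchange, hw])
  rw [← ppt_mulVec_exchange_iff hdef, exchange_exchange, exchange_exchange] at hM
  exact hM.symm
end

section
/- Let M be an n×n matrix over a field F and let X be a set of indices such that M∗X is defined. Regard F^n as the direct sum of the subspace of coordinates indexed by X and the subspace of coordinates indexed by the complement of X, writing vectors as pairs (x₁, x₂) accordingly. Then for all x₁, y₁ in the X-part and all x₂, y₂ in the complementary part: M·(x₁, x₂) = (y₁, y₂) if and only if (M∗X)·(y₁, x₂) = (x₁, y₂). -/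
open Matrix

/-- Assemble a vector indexed by `n` from its `X`-part `x₁` and its `Xᶜ`-part `x₂`. -/
def glue {F : Type*} {n : Type*} [Fintype n] [DecidableEq n] (X : Finset n)
    (x₁ : {x // x ∈ X} → F) (x₂ : {x // x ∈ Xᶜ} → F) : n → F :=
  fun a => if h : a ∈ X then x₁ ⟨a, h⟩ else x₂ ⟨a, Finset.mem_compl.mpr h⟩

theorem glue_inj {F n : Type*} [Fintype n] [DecidableEq n] (X : Finset n)
    {x₁ y₁ : {x // x ∈ X} → F} {x₂ y₂ : {x // x ∈ Xᶜ} → F} :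
    glue X x₁ x₂ = glue X y₁ y₂ ↔ x₁ = y₁ ∧ x₂ = y₂ := by
  refine ⟨fun h => ⟨funext fun a => ?_, funext fun a => ?_⟩, by rintro ⟨rfl, rfl⟩; rfl⟩
  · simpa [glue] using congrFun h a.1
  · simpa [glue, Finset.mem_compl.mp a.2] using congrFun h a.1

section Blocks

variable {F : Type*} [Field F] {n : Type*} [Fintype n] [DecidableEq n]

theorem mulVec_glue (M : Matrix n n F) (X : Finset n)
    (x₁ : {x // x ∈ X} → F) (x₂ : {x // x ∈ Xᶜ} → F) :
    M *ᵥ glue X x₁ x₂ = glue X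
      (M.submatrix Subtype.val Subtype.val *ᵥ x₁ + M.submatrix Subtype.val Subtype.val *ᵥ x₂)
      (M.submatrix Subtype.val Subtype.val *ᵥ x₁ + M.submatrix Subtype.val Subtype.val *ᵥ x₂) := by
  have sum_glue (i : n) : (M *ᵥ glue X x₁ x₂) i =
      ∑ a : {x // x ∈ X}, M i a * x₁ a + ∑ a : {x // x ∈ Xᶜ}, M i a * x₂ a := by
    rw [mulVec, dotProduct, ← Finset.sum_add_sum_compl X, ← Finset.sum_coe_sort X,
      ← Finset.sum_coe_sort Xᶜ]
    congr 1
    · exact Finset.sum_congr rfl fun a _ => by simp [glue]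
    · exact Finset.sum_congr rfl fun a _ => by simp [glue, Finset.mem_compl.mp a.2]
  funext i
  rw [sum_glue]
  by_cases hi : i ∈ X <;> simp [glue, hi, mulVec, dotProduct]

/-- The four blocks of the principal pivot transform act as expected on a glued vector. -/
theorem ppt_mulVec_glue (M : Matrix n n F) (X : Finset n)
    (P : Matrix {x // x ∈ X} {x // x ∈ X} F) (hP : P = M.submatrix Subtype.val Subtype.val)
    (Q : Matrix {x // x ∈ X} {x // x ∈ Xᶜ} F) (hQ : Q = M.submatrix Subtype.val Subtype.val)
    (R : Matrix {x // x ∈ Xᶜ} {x // x ∈ X} F) (hR : R = M.submatrix Subtype.val Subtype.val)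
    (S : Matrix {x // x ∈ Xᶜ} {x // x ∈ Xᶜ} F) (hS : S = M.submatrix Subtype.val Subtype.val)
    (y₁ : {x // x ∈ X} → F) (x₂ : {x // x ∈ Xᶜ} → F) :
    ppt M X *ᵥ glue X y₁ x₂ =
      glue X (P⁻¹ *ᵥ y₁ + -(P⁻¹ * Q) *ᵥ x₂) ((R * P⁻¹) *ᵥ y₁ + (S - R * P⁻¹ * Q) *ᵥ x₂) := by
  subst hP hQ hR hS
  rw [mulVec_glue]
  congr 3 <;> ext i j
  · simp [ppt]
  · simp [ppt, Finset.mem_compl.mp j.2]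
  · simp [ppt, Finset.mem_compl.mp i.2]
  · simp [ppt, Finset.mem_compl.mp i.2, Finset.mem_compl.mp j.2]

end Blocks

/-- **Theorem (Statement 12).** Regarding `Fⁿ` as the direct sum of the coordinates
indexed by `X` and those indexed by its complement, `M · (x₁, x₂) = (y₁, y₂)` if and
only if `(M ∗ X) · (y₁, x₂) = (x₁, y₂)`. -/
theorem ppt_exchange {F : Type*} [Field F] {n : Type*} [Fintype n] [DecidableEq n]
    (M : Matrix n n F) (X : Finset n) (hX : PptDefined M X)
    (x₁ y₁ : {x // x ∈ X} → F) (x₂ y₂ : {x // x ∈ Xᶜ} → F) :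
    M *ᵥ glue X x₁ x₂ = glue X y₁ y₂ ↔ ppt M X *ᵥ glue X y₁ x₂ = glue X x₁ y₂ := by
  rw [mulVec_glue, ppt_mulVec_glue M X _ rfl _ rfl _ rfl _ rfl, glue_inj, glue_inj]
  unfold PptDefined at hX
  generalize M.submatrix (Subtype.val : {x // x ∈ X} → n) (Subtype.val : {x // x ∈ X} → n) = P
    at hX ⊢
  generalize M.submatrix (Subtype.val : {x // x ∈ X} → n) (Subtype.val : {x // x ∈ Xᶜ} → n) = Q
  generalize M.submatrix (Subtype.val : {x // x ∈ Xᶜ} → n) (Subtype.val : {x // x ∈ X} → n) = R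
  have hdet : IsUnit P.det := (Matrix.isUnit_iff_isUnit_det P).mp hX
  have solve : P *ᵥ x₁ + Q *ᵥ x₂ = y₁ ↔ P⁻¹ *ᵥ y₁ + -(P⁻¹ * Q) *ᵥ x₂ = x₁ := by
    constructor <;> rintro rfl
    · simp [mulVec_add, neg_mulVec, Matrix.nonsing_inv_mul P hdet]
    · simp [mulVec_add, mulVec_neg, neg_mulVec, ← Matrix.mul_assoc, Matrix.mul_nonsing_inv P hdet]
  rw [solve]
  refine and_congr_right fun h => ?_
  rw [← h]
  simp only [mulVec_add, mulVec_mulVec, neg_mulVec, mulVec_neg, sub_mulVec, Matrix.mul_assoc]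
  rw [add_assoc, neg_add_eq_sub]
end

section
/- Let M be a symmetric n×n matrix over GF(2) and let i be an index with M_{ii} = 1. Then the principal pivot transform M∗{i} is defined, and M∗{i} equals the non-simple local complement of M at i, i.e., the matrix whose (j,k) entry is M_{jk} + M_{ij}·M_{ik} for all j, k ≠ i and whose row i and column i equal those of M. -/
open Matrix

theorem submatrix_singleton_eq_one {R n : Type*} [Zero R] [One R] [DecidableEq n]
    (M : Matrix n n R) (i : n) (hi : M i i = 1) :
    M.submatrix (Subtype.val : {x // x ∈ ({i} : Finset n)} → n)
      (Subtype.val : {x // x ∈ ({i} : Finset n)} → n) = 1 := by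
  ext ⟨a, ha⟩ ⟨b, hb⟩
  obtain rfl := Finset.mem_singleton.mp ha
  obtain rfl := Finset.mem_singleton.mp hb
  simp [hi]

/-- **Theorem (Statement 14).** If `M` is symmetric over `GF(2)` and `M i i = 1`, then
`M ∗ {i}` is defined and equals the non-simple local complement of `M` at `i`. -/
theorem ppt_singleton_eq_nslc {n : Type*} [Fintype n] [DecidableEq n]
    (M : Matrix n n (ZMod 2)) (hM : M.IsSymm) (i : n) (hi : M i i = 1) :
    PptDefined M {i} ∧ ppt M {i} = nslc M i := by
  have hP := submatrix_singleton_eq_one M i hi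
  refine ⟨by rw [PptDefined, hP]; exact isUnit_one, ?_⟩
  ext j k
  simp only [ppt, nslc, hP, inv_one, Matrix.one_mul, Matrix.mul_one]
  by_cases hj : j = i <;> by_cases hk : k = i
  · subst hj hk
    simp [hi]
  · simp [hj, hk, ZMod.neg_eq_self_mod_two]
  · simp [hj, hk]
  · simp [hj, hk, Matrix.mul_apply, hM.apply i j, CharTwo.sub_eq_add]
end

section
/- Let M be a symmetric n×n matrix over GF(2) and let i ≠ j be indices with M_{ii} = M_{jj} = 0 and M_{ij} = 1. Then the principal pivot transform M∗{i,j} is defined, and M∗{i,j} equals the pivot M^{ij}, i.e., the triple simple local complement ((M^i)^j)^i. -/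
open Matrix

/-- Summation over the coerced pair `{i, j}`. -/
theorem sum_subtype_pair {n R : Type*} [DecidableEq n] [AddCommMonoid R] {i j : n}
    (hij : i ≠ j) (f : n → R) :
    ∑ x : {x // x ∈ ({i, j} : Finset n)}, f x = f i + f j := by
  rw [Finset.sum_coe_sort ({i, j} : Finset n) f, Finset.sum_pair hij]

/-- A principal `2 × 2` submatrix `[[0, 1], [1, 0]]` is an involution. -/
theorem submatrix_pair_mul_self {n F : Type*} [DecidableEq n] [Field F]
    {M : Matrix n n F} {i j : n} (hij : i ≠ j) (hii : M i i = 0) (hjj : M j j = 0)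
    (hij1 : M i j = 1) (hji1 : M j i = 1) :
    M.submatrix (Subtype.val : {x // x ∈ ({i, j} : Finset n)} → n)
      (Subtype.val : {x // x ∈ ({i, j} : Finset n)} → n) *
    M.submatrix (Subtype.val : {x // x ∈ ({i, j} : Finset n)} → n)
      (Subtype.val : {x // x ∈ ({i, j} : Finset n)} → n) = 1 := by
  ext ⟨a, ha⟩ ⟨b, hb⟩
  simp only [mul_apply, submatrix_apply, one_apply, Subtype.mk.injEq]
  rw [sum_subtype_pair hij fun x => M a x * M x b]
  simp only [Finset.mem_insert, Finset.mem_singleton] at ha hb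
  rcases ha with rfl | rfl <;> rcases hb with rfl | rfl <;> simp [*, hij.symm]

/-- Entries of the principal pivot transform on a pair `{i, j}` whose principal submatrix is
`[[0, 1], [1, 0]]`. -/
theorem ppt_pair_apply {n F : Type*} [Fintype n] [DecidableEq n] [Field F]
    {M : Matrix n n F} {i j : n} (hij : i ≠ j) (hii : M i i = 0) (hjj : M j j = 0)
    (hij1 : M i j = 1) (hji1 : M j i = 1) (a b : n) :
    ppt M {i, j} a b =
      if a ∈ ({i, j} : Finset n) then
        if b ∈ ({i, j} : Finset n) then M a b else -(M a i * M i b + M a j * M j b)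
      else
        if b ∈ ({i, j} : Finset n) then M a i * M i b + M a j * M j b
        else M a b - (M a j * M i b + M a i * M j b) := by
  have hinv := inv_eq_right_inv (submatrix_pair_mul_self hij hii hjj hij1 hji1)
  simp only [ppt, hinv]
  split_ifs with ha hb hb
  · rfl
  · change -∑ x : {x // x ∈ ({i, j} : Finset n)}, M a x * M x b = _
    rw [sum_subtype_pair hij fun x => M a x * M x b]
  · change ∑ x : {x // x ∈ ({i, j} : Finset n)}, M a x * M x b = _
    rw [sum_subtype_pair hij fun x => M a x * M x b]
  · change M a b - ∑ x : {x // x ∈ ({i, j} : Finset n)},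
      (∑ y : {x // x ∈ ({i, j} : Finset n)}, M a y * M y x) * M x b = _
    rw [sum_subtype_pair hij
      fun x => (∑ y : {x // x ∈ ({i, j} : Finset n)}, M a y * M y x) * M x b,
      sum_subtype_pair hij fun y => M a y * M y i, sum_subtype_pair hij fun y => M a y * M y j]
    simp [*]

/-- **Theorem (Statement 15).** If `M` is symmetric over `GF(2)` with
`M i i = M j j = 0` and `M i j = 1` (`i ≠ j`), then `M ∗ {i, j}` is defined and equals
the pivot `M^{ij} = ((M^i)^j)^i`. -/
theorem ppt_pair_eq_pivot {n : Type*} [Fintype n] [DecidableEq n]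
    (M : Matrix n n (ZMod 2)) (hM : M.IsSymm) (i j : n) (hij : i ≠ j)
    (hii : M i i = 0) (hjj : M j j = 0) (hij1 : M i j = 1) :
    PptDefined M {i, j} ∧ ppt M {i, j} = slc (slc (slc M i) j) i := by
  have hji1 : M j i = 1 := (hM.apply i j).trans hij1
  have hP := submatrix_pair_mul_self hij hii hjj hij1 hji1
  refine ⟨IsUnit.of_mul_eq_one _ hP, ?_⟩
  ext a b
  rw [ppt_pair_apply hij hii hjj hij1 hji1]
  have hai := hM.apply i a
  have haj := hM.apply j a
  simp only [slc, Finset.mem_insert, Finset.mem_singleton]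
  grind
end
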